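/- arXiv:1809.09256 — 4 statements merged into one kernel-verified Lean document; each statement's English description precedes it below -/
import Mathlib

section
/- Let R be a reduced Noetherian ring whose normalization R^N (the integral closure of R in its total ring of fractions) is module-finite over R, and let c = Ann_R(R^N/R) be the conductor. Let D be the intersection, inside the total ring of fractions of R^N/√(c R^N), of the seminormalization (R/√(c R))^SN with R^N/√(c R^N). Then the pullback C of the diagram R^N → R^N/√(c R^N) ← D (i.e. C = {(x, d) ∈ R^N × D : the image of x in R^N/√(c R^N) equals the image of d}) is the seminormalization of R. -/
universe u v

set_option synthInstance.maxHeartbeats 1000000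
set_option maxHeartbeats 1000000

/-- A ring homomorphism is *birational* if it carries nonzerodivisors to nonzerodivisors and
the induced map on total rings of fractions is bijective. -/
def IsBirationalHom {A : Type u} {B : Type v} [CommRing A] [CommRing B] (f : A →+* B) : Prop :=
  ∃ hle : nonZeroDivisors A ≤ Submonoid.comap f (nonZeroDivisors B),
    Function.Bijective
      (IsLocalization.map (M := nonZeroDivisors A) (T := nonZeroDivisors B)
        (FractionRing B) f hle : FractionRing A →+* FractionRing B)

/-- A ring homomorphism induces isomorphisms of all residue fields if for every prime `q`
of the target, the induced map on residue fields `κ(q.comap f) → κ(q)` is bijective. -/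
def InducesResidueFieldIsos {A : Type u} {B : Type v} [CommRing A] [CommRing B]
    (f : A →+* B) : Prop :=
  ∀ (q : Ideal B) [q.IsPrime],
    Function.Bijective
      (IsLocalRing.ResidueField.map (Localization.localRingHom (q.comap f) q f rfl))

/-- A commutative ring `A` is seminormal if every finite birational (injective) extension
which induces a bijection on prime spectra and isomorphisms of all residue fields is an
isomorphism. -/
def IsSeminormalRing (A : Type u) [CommRing A] : Prop :=
  ∀ (B : Type u) [CommRing B] (f : A →+* B),
    Function.Injective f → f.Finite → IsBirationalHom f →
    Function.Bijective (PrimeSpectrum.comap f) →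
    InducesResidueFieldIsos f →
    Function.Bijective f

/-- `S` is the seminormalization of `R` if it is the smallest seminormal intermediate ring
between `R` and the normalization `R^N` (the integral closure of `R` in its total ring of
fractions). -/
def IsSeminormalization (R : Type u) [CommRing R]
    (S : Subalgebra R (FractionRing R)) : Prop :=
  S ≤ integralClosure R (FractionRing R) ∧ IsSeminormalRing S ∧
    ∀ T : Subalgebra R (FractionRing R),
      T ≤ integralClosure R (FractionRing R) → IsSeminormalRing T → S ≤ T

/-- The conductor `Ann_R (R^N / R)` of a commutative ring in its normalization. -/
noncomputable def conductorIdeal (R : Type u) [CommRing R] : Ideal R :=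
  Module.annihilator R
    (↥(integralClosure R (FractionRing R)) ⧸
      LinearMap.range (Algebra.linearMap R ↥(integralClosure R (FractionRing R))))

/-- The pullback (fiber product) of a diagram of ring maps `A → T ← B`, realized as the
subring of `A × B` of pairs with equal images in `T`. -/
def ringPullback {A : Type u} {B : Type v} {T : Type*} [CommRing A] [CommRing B] [CommRing T]
    (f : A →+* T) (g : B →+* T) : Subring (A × B) :=
  RingHom.eqLocus (f.comp (RingHom.fst A B)) (g.comp (RingHom.snd A B))
/-- `R/√(cR)` where `c` is the conductor. -/
noncomputable def AQuot (R : Type u) [CommRing R] : Type u :=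
  R ⧸ (conductorIdeal R).radical

noncomputable instance (R : Type u) [CommRing R] : CommRing (AQuot R) :=
  inferInstanceAs (CommRing (R ⧸ (conductorIdeal R).radical))

/-- `R^N/√(c R^N)` where `c` is the conductor. -/
noncomputable def NQuot (R : Type u) [CommRing R] : Type u :=
  ↥(integralClosure R (FractionRing R)) ⧸
    ((conductorIdeal R).map
      (algebraMap R ↥(integralClosure R (FractionRing R)))).radical

noncomputable instance (R : Type u) [CommRing R] : CommRing (NQuot R) :=
  inferInstanceAs (CommRing (↥(integralClosure R (FractionRing R)) ⧸
    ((conductorIdeal R).map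
      (algebraMap R ↥(integralClosure R (FractionRing R)))).radical))

/-- The quotient map `R^N → R^N/√(c R^N)`. -/
noncomputable def nQuotMk (R : Type u) [CommRing R] :
    ↥(integralClosure R (FractionRing R)) →+* NQuot R :=
  Ideal.Quotient.mk _

/-- The quotient map `R → R/√(cR)`. -/
noncomputable def aQuotMk (R : Type u) [CommRing R] : R →+* AQuot R :=
  Ideal.Quotient.mk _

/-- The natural map `R/√(cR) → R^N/√(c R^N)`. -/
noncomputable def condQuotMap (R : Type u) [CommRing R] : AQuot R →+* NQuot R :=
  Ideal.Quotient.lift _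
    ((nQuotMk R).comp (algebraMap R ↥(integralClosure R (FractionRing R))))
    (fun a ha => Ideal.Quotient.eq_zero_iff_mem.mpr
      (Ideal.map_radical_le (f := algebraMap R ↥(integralClosure R (FractionRing R)))
        (Ideal.mem_map_of_mem _ ha)))

/-- The natural map `R/c → R^N/(c R^N)`. -/
noncomputable def plainCondQuotMap (R : Type u) [CommRing R] :
    R ⧸ conductorIdeal R →+*
      (↥(integralClosure R (FractionRing R)) ⧸
        (conductorIdeal R).map (algebraMap R ↥(integralClosure R (FractionRing R)))) :=
  Ideal.Quotient.lift _
    ((Ideal.Quotient.mk _).comp (algebraMap R ↥(integralClosure R (FractionRing R))))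
    (fun a ha => Ideal.Quotient.eq_zero_iff_mem.mpr (Ideal.mem_map_of_mem _ ha))
section helpers

/-- `x` takes, over every prime of `A`, a single value which is rational over `A`. -/
def WMem {A : Type u} {B : Type v} [CommRing A] [CommRing B] (f : A →+* B) (x : B) : Prop :=
  ∀ p : Ideal A, p.IsPrime → ∃ a b : A, b ∉ p ∧
    ∀ q : Ideal B, q.IsPrime → q.comap f = p → f b * x - f a ∈ q

theorem WMem.map {A : Type*} {B : Type*} [CommRing A] [CommRing B] (f : A →+* B) (a : A) :
    WMem f (f a) := fun p hp => ⟨a, 1, fun h => hp.ne_top ((Ideal.eq_top_iff_one _).2 h),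
      fun q hq h => by simp⟩

theorem WMem.add {A : Type*} {B : Type*} [CommRing A] [CommRing B] {f : A →+* B} {x y : B}
    (hx : WMem f x) (hy : WMem f y) : WMem f (x + y) := by
  intro p hp
  obtain ⟨a, b, hb, h⟩ := hx p hp
  obtain ⟨a', b', hb', h'⟩ := hy p hp
  refine ⟨a * b' + a' * b, b * b', fun h => (hp.mem_or_mem h).elim hb hb', fun q hq hqp => ?_⟩
  have := q.add_mem (q.mul_mem_left (f b') (h q hq hqp)) (q.mul_mem_left (f b) (h' q hq hqp))
  convert this using 1
  simp only [map_add, map_mul]; ring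

theorem WMem.mul {A : Type*} {B : Type*} [CommRing A] [CommRing B] {f : A →+* B} {x y : B}
    (hx : WMem f x) (hy : WMem f y) : WMem f (x * y) := by
  intro p hp
  obtain ⟨a, b, hb, h⟩ := hx p hp
  obtain ⟨a', b', hb', h'⟩ := hy p hp
  refine ⟨a * a', b * b', fun h => (hp.mem_or_mem h).elim hb hb', fun q hq hqp => ?_⟩
  have := q.add_mem (q.mul_mem_left (f b' * y) (h q hq hqp))
    (q.mul_mem_left (f a) (h' q hq hqp))
  convert this using 1
  simp only [map_mul]; ring

/-- lying over for ring homs -/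
theorem lyingOver {A : Type*} {B : Type*} [CommRing A] [CommRing B] (f : A →+* B)
    (hf : Function.Injective f) (hi : f.IsIntegral) (p : Ideal A) (hp : p.IsPrime) :
    ∃ q : Ideal B, q.IsPrime ∧ q.comap f = p := by
  let _ := f.toAlgebra
  have : Algebra.IsIntegral A B := ⟨hi⟩
  obtain ⟨q, -, hq, h⟩ := Ideal.exists_ideal_over_prime_of_isIntegral (S := B) p ⊥ (by
    intro x hx
    have : f x = 0 := hx
    rw [(map_eq_zero_iff f hf).1 this]; exact p.zero_mem)
  exact ⟨q, hq, h⟩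

theorem WMem.descend {A : Type*} {B : Type*} {C : Type*} [CommRing A] [CommRing B] [CommRing C]
    {f : A →+* B} {g : B →+* C} (hg : Function.Injective g) (hi : g.IsIntegral) {x : B}
    (hx : WMem (g.comp f) (g x)) : WMem f x := by
  intro p hp
  obtain ⟨a, b, hb, h⟩ := hx p hp
  refine ⟨a, b, hb, fun q hq hqp => ?_⟩
  obtain ⟨Q, hQ, rfl⟩ := lyingOver g hg hi q hq
  have := h Q hQ (by rw [← Ideal.comap_comap]; exact hqp)
  simpa using this

theorem comap_bijective_of_WMem {A : Type*} {B : Type*} [CommRing A] [CommRing B] {f : A →+* B}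
    (hf : Function.Injective f) (hi : f.IsIntegral) (hW : ∀ x, WMem f x) :
    Function.Bijective (PrimeSpectrum.comap f) := by
  constructor
  · have key : ∀ q q' : Ideal B, q.IsPrime → q'.IsPrime → q.comap f = q'.comap f → q ≤ q' := by
      intro q q' hq hq' h x hx
      obtain ⟨a, b, hb, H⟩ := hW x (q.comap f) (hq.comap f)
      have h1 := H q hq rfl
      have h2 := H q' hq' h.symm
      have ha : a ∈ q.comap f := by
        have := q.sub_mem (q.mul_mem_left (f b) hx) h1
        simpa using this
      rw [h] at ha hb
      have := q'.add_mem h2 ha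
      simp only [sub_add_cancel] at this
      exact (hq'.mem_or_mem this).resolve_left hb
    intro q q' h
    have h' : q.asIdeal.comap f = q'.asIdeal.comap f := congrArg PrimeSpectrum.asIdeal h
    exact PrimeSpectrum.ext (le_antisymm (key _ _ q.2 q'.2 h') (key _ _ q'.2 q.2 h'.symm))
  · intro p
    obtain ⟨q, hq, h⟩ := lyingOver f hf hi p.asIdeal p.2
    exact ⟨⟨q, hq⟩, PrimeSpectrum.ext h⟩

theorem residue_surj_iff {A : Type*} {B : Type*} [CommRing A] [CommRing B] (f : A →+* B)
    (q : Ideal B) [q.IsPrime] :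
    Function.Bijective
      (IsLocalRing.ResidueField.map (Localization.localRingHom (q.comap f) q f rfl)) ↔
    ∀ x : B, ∃ a b : A, f b ∉ q ∧ f b * x - f a ∈ q := by
  have hm : ∀ r : A, (IsLocalRing.ResidueField.map (Localization.localRingHom (q.comap f) q f rfl))
      (algebraMap A (q.comap f).ResidueField r) = algebraMap B q.ResidueField (f r) :=
    fun r => Ideal.ResidueField.map_algebraMap (q.comap f) q f rfl r
  constructor
  · intro h x
    obtain ⟨z, hz⟩ := h.2 (algebraMap B q.ResidueField x)
    obtain ⟨a, b, hb, rfl⟩ := IsFractionRing.div_surjective (A := A ⧸ q.comap f) z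
    obtain ⟨a, rfl⟩ := Ideal.Quotient.mk_surjective a
    obtain ⟨b, rfl⟩ := Ideal.Quotient.mk_surjective b
    simp only [Ideal.algebraMap_quotient_residueField_mk] at hz
    rw [map_div₀] at hz
    erw [hm, hm] at hz
    have hb' : f b ∉ q := by
      intro h
      have := nonZeroDivisors.ne_zero hb
      exact this (Ideal.Quotient.eq_zero_iff_mem.2 h)
    refine ⟨a, b, hb', ?_⟩
    rw [← Ideal.algebraMap_residueField_eq_zero, map_sub, map_mul, sub_eq_zero, ← hz]
    rw [mul_div_cancel₀]
    rwa [Ne, Ideal.algebraMap_residueField_eq_zero]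
  · intro h
    refine ⟨RingHom.injective _, fun z => ?_⟩
    have key : ∀ x : B, ∃ y, (IsLocalRing.ResidueField.map
        (Localization.localRingHom (q.comap f) q f rfl)) y = algebraMap B q.ResidueField x := by
      intro x
      obtain ⟨a, b, hb, hx⟩ := h x
      refine ⟨algebraMap A (q.comap f).ResidueField a / algebraMap A (q.comap f).ResidueField b, ?_⟩
      rw [map_div₀]
      erw [hm, hm]
      rw [← Ideal.algebraMap_residueField_eq_zero, map_sub, map_mul, sub_eq_zero] at hx
      rw [← hx, mul_div_cancel_left₀]
      rwa [Ne, Ideal.algebraMap_residueField_eq_zero]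
    obtain ⟨a, b, hb, rfl⟩ := IsFractionRing.div_surjective (A := B ⧸ q) z
    obtain ⟨a, rfl⟩ := Ideal.Quotient.mk_surjective a
    obtain ⟨b, rfl⟩ := Ideal.Quotient.mk_surjective b
    simp only [Ideal.algebraMap_quotient_residueField_mk]
    obtain ⟨y, hy⟩ := key a
    obtain ⟨y', hy'⟩ := key b
    exact ⟨y / y', by rw [map_div₀, hy, hy']⟩

theorem isFractionRing_mid {R B K : Type*} [CommRing R] [CommRing B] [CommRing K] [Algebra R K]
    [Algebra B K] [IsFractionRing R K] (g : R →+* B)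
    (hg : ∀ r, algebraMap B K (g r) = algebraMap R K r)
    (hinj : Function.Injective (algebraMap B K)) : IsFractionRing B K := by
  have hginj : Function.Injective g := by
    intro x y h
    apply IsFractionRing.injective R K
    rw [← hg, ← hg, h]
  have hnz : ∀ s ∈ nonZeroDivisors R, g s ∈ nonZeroDivisors B := by
    intro s hs
    rw [mem_nonZeroDivisors_iff_right]
    intro z hz
    apply hinj
    have hu := IsLocalization.map_units K (⟨s, hs⟩ : nonZeroDivisors R)
    rw [map_zero]
    apply hu.mul_left_injective
    simp only [zero_mul]
    rw [← hg, ← map_mul, hz, map_zero]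
  refine (isLocalization_iff _ _).2 ⟨?_, ?_, ?_⟩
  · intro b
    obtain ⟨⟨r, s⟩, h⟩ := IsLocalization.surj (nonZeroDivisors R) (algebraMap B K b)
    simp only at h
    have hb : (b : B) * g s = g r := by
      apply hinj; rw [map_mul, hg, hg, h]
    have hr : r ∈ nonZeroDivisors R := by
      rw [mem_nonZeroDivisors_iff_right]
      intro z hz
      have h1 : g r ∈ nonZeroDivisors B := hb ▸ mul_mem b.2 (hnz _ s.2)
      apply hginj
      rw [map_zero]
      apply (mem_nonZeroDivisors_iff_right.1 h1)
      rw [← map_mul, hz, map_zero]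
    have hu := IsLocalization.map_units K (⟨r, hr⟩ : nonZeroDivisors R)
    simp only at hu
    rw [← h] at hu
    exact isUnit_of_mul_isUnit_left hu
  · intro z
    obtain ⟨⟨r, s⟩, h⟩ := IsLocalization.surj (nonZeroDivisors R) z
    exact ⟨(g r, ⟨g s, hnz _ s.2⟩), by simpa [hg] using h⟩
  · intro x y h
    exact ⟨1, by simpa using hinj h⟩

theorem birational_of_mid {A B K : Type*} [CommRing A] [CommRing B] [CommRing K] [Algebra A K]
    [Algebra B K] [IsFractionRing A K] [IsFractionRing B K] (f : A →+* B)
    (hf : ∀ a, algebraMap B K (f a) = algebraMap A K a) : IsBirationalHom f := by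
  have hle : nonZeroDivisors A ≤ Submonoid.comap f (nonZeroDivisors B) := by
    intro s hs
    rw [Submonoid.mem_comap, mem_nonZeroDivisors_iff_right]
    intro z hz
    apply IsFractionRing.injective B K
    have hu := IsLocalization.map_units K (⟨s, hs⟩ : nonZeroDivisors A)
    rw [map_zero]
    apply hu.mul_left_injective
    simp only [zero_mul]
    rw [← hf, ← map_mul, hz, map_zero]
  refine ⟨hle, ?_⟩
  let eA := (FractionRing.algEquiv A K)
  let eB := (FractionRing.algEquiv B K)
  have : ((eB : FractionRing B →+* K).comp (IsLocalization.map (M := nonZeroDivisors A)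
      (T := nonZeroDivisors B) (FractionRing B) f hle : FractionRing A →+* FractionRing B))
      = (eA : FractionRing A →+* K) := by
    apply IsLocalization.ringHom_ext (nonZeroDivisors A)
    ext a
    simp [eA, eB, hf]
  have h2 : Function.Bijective (eB ∘ (IsLocalization.map (M := nonZeroDivisors A)
      (T := nonZeroDivisors B) (FractionRing B) f hle : FractionRing A →+* FractionRing B)) := by
    have h3 := congrArg (fun g : FractionRing A →+* K => (g : FractionRing A → K)) this
    change eB ∘ _ = eA at h3
    rw [h3]; exact eA.bijective
  exact (Function.Bijective.of_comp_iff' eB.bijective _).1 h2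

/-- The seminormalization, described by values at primes. -/
noncomputable def WSub (R : Type u) [CommRing R] : Subalgebra R (FractionRing R) where
  carrier := {x | ∃ h : x ∈ integralClosure R (FractionRing R),
    WMem (algebraMap R ↥(integralClosure R (FractionRing R))) ⟨x, h⟩}
  mul_mem' := by
    rintro x y ⟨hx, hx'⟩ ⟨hy, hy'⟩
    exact ⟨mul_mem hx hy, hx'.mul hy'⟩
  add_mem' := by
    rintro x y ⟨hx, hx'⟩ ⟨hy, hy'⟩
    exact ⟨add_mem hx hy, hx'.add hy'⟩
  algebraMap_mem' := fun r => ⟨Subalgebra.algebraMap_mem _ r, WMem.map _ r⟩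

theorem algebraMap_isIntegral_of_le {R K : Type*} [CommRing R] [CommRing K] [Algebra R K]
    (S : Subalgebra R K) (hS : S ≤ integralClosure R K) : (algebraMap R S).IsIntegral := by
  intro x
  have h : IsIntegral R (x : K) := hS x.2
  exact (isIntegral_algHom_iff S.val Subtype.val_injective).1 h

theorem inclusion_isIntegral {R K : Type*} [CommRing R] [CommRing K] [Algebra R K]
    (S : Subalgebra R K) (hS : S ≤ integralClosure R K) :
    (Subalgebra.inclusion hS).toRingHom.IsIntegral := by
  have h := algebraMap_isIntegral_of_le (integralClosure R K) le_rfl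
  rw [← (Subalgebra.inclusion hS).comp_algebraMap] at h
  exact h.tower_top

theorem WSub_isSeminormal (R : Type u) [CommRing R] : IsSeminormalRing (WSub R) := by
  intro B _ f hinj hfin hbir hspec hres
  refine ⟨hinj, ?_⟩
  have hW : WSub R ≤ integralClosure R (FractionRing R) := fun x hx => hx.1
  have hfrac : IsFractionRing (WSub R) (FractionRing R) :=
    isFractionRing_mid (R := R) (algebraMap R (WSub R)) (fun r => rfl) Subtype.val_injective
  obtain ⟨hle, hb⟩ := hbir
  let φ : FractionRing (WSub R) ≃+* FractionRing B := RingEquiv.ofBijective _ hb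
  let e := FractionRing.algEquiv (WSub R) (FractionRing R)
  let θ : B →+* FractionRing R :=
    ((e : FractionRing (WSub R) →+* FractionRing R).comp (φ.symm : _ →+* _)).comp
      (algebraMap B (FractionRing B))
  have hθinj : Function.Injective θ :=
    (e.injective.comp φ.symm.injective).comp (IsFractionRing.injective B (FractionRing B))
  have hθf : ∀ w, θ (f w) = (w : FractionRing R) := by
    intro w
    have h1 : φ (algebraMap _ _ w) = algebraMap B (FractionRing B) (f w) :=
      IsLocalization.map_eq hle w
    change e (φ.symm (algebraMap B (FractionRing B) (f w))) = _
    rw [← h1, RingEquiv.symm_apply_apply, AlgEquiv.commutes]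
    rfl
  have hintg : (f.comp (algebraMap R (WSub R))).IsIntegral :=
    RingHom.IsIntegral.trans _ _ (algebraMap_isIntegral_of_le _ hW) hfin.to_isIntegral
  have hθint : ∀ b, θ b ∈ integralClosure R (FractionRing R) := by
    intro b
    obtain ⟨P, hP, h0⟩ := hintg b
    refine ⟨P, hP, ?_⟩
    have := congrArg θ h0
    rw [Polynomial.hom_eval₂, map_zero] at this
    have hc : algebraMap R (FractionRing R) = θ.comp (f.comp (algebraMap R (WSub R))) := by
      apply RingHom.ext
      intro r
      exact (hθf (algebraMap R (WSub R) r)).symm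
    rw [hc]
    exact this
  let θ' : B →+* integralClosure R (FractionRing R) :=
    θ.codRestrict (integralClosure R (FractionRing R)) hθint
  have hιint := inclusion_isIntegral (WSub R) hW
  have hιinj := Subalgebra.inclusion_injective hW
  have hθ'f : θ'.comp f = (Subalgebra.inclusion hW).toRingHom := by
    apply RingHom.ext
    intro w
    exact Subtype.ext (hθf w)
  -- W → N : all values are W
  have hWW : ∀ w : WSub R, WMem (algebraMap R (WSub R)) w := by
    intro w
    refine WMem.descend (g := (Subalgebra.inclusion hW).toRingHom)
      hιinj hιint ?_
    exact w.2.2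
  have hbij := comap_bijective_of_WMem (f := algebraMap R (WSub R))
    (fun x y h => IsFractionRing.injective R (FractionRing R) (congrArg Subtype.val h))
    (algebraMap_isIntegral_of_le _ hW) hWW
  have hall : ∀ b, WMem (θ'.comp (f.comp (algebraMap R (WSub R)))) (θ' b) := by
    intro b p hp
    obtain ⟨P, hP⟩ := hbij.2 ⟨p, hp⟩
    obtain ⟨Q, hQ⟩ := hspec.2 P
    have hQp := Q.2
    obtain ⟨u, v, hv, huv⟩ := (residue_surj_iff f Q.asIdeal).1 (hres Q.asIdeal) b
    obtain ⟨a1, b1, hb1, h1⟩ := hWW u p hp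
    obtain ⟨a2, b2, hb2, h2⟩ := hWW v p hp
    have hPp : P.asIdeal.comap (algebraMap R (WSub R)) = p := congrArg PrimeSpectrum.asIdeal hP
    have hQP : Q.asIdeal.comap f = P.asIdeal := congrArg PrimeSpectrum.asIdeal hQ
    have h1' := h1 _ P.2 hPp
    have h2' := h2 _ P.2 hPp
    have hvP : v ∉ P.asIdeal := by rw [← hQP]; exact hv
    have ha2 : a2 ∉ p := by
      intro h
      rw [← hPp] at h hb2
      have := P.asIdeal.add_mem h2' h
      rw [sub_add_cancel] at this
      exact (P.2.mem_or_mem this).elim hb2 hvP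
    refine ⟨b2 * a1, b1 * a2, fun h => (hp.mem_or_mem h).elim hb1 ha2, fun q hq hqp => ?_⟩
    have hqQ : (⟨q.comap θ', hq.comap θ'⟩ : PrimeSpectrum B) = Q := by
      apply hspec.1
      apply hbij.1
      rw [hQ, hP]
      apply PrimeSpectrum.ext
      exact hqp
    have hqQ' : q.comap θ' = Q.asIdeal := congrArg PrimeSpectrum.asIdeal hqQ
    rw [← hQP, ← hqQ'] at h1' h2'
    rw [← hqQ'] at huv
    have e1 : θ' (f (algebraMap R _ b1 * u - algebraMap R _ a1)) ∈ q := h1'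
    have e2 : θ' (f (algebraMap R _ b2 * v - algebraMap R _ a2)) ∈ q := h2'
    have e3 : θ' (f v * b - f u) ∈ q := huv
    simp only [map_sub, map_mul] at e1 e2 e3
    have := q.sub_mem (q.add_mem (q.mul_mem_left (θ' (f (algebraMap R _ b1)) * θ' (f (algebraMap R _ b2))) e3)
      (q.mul_mem_left (θ' (f (algebraMap R _ b2))) e1))
      (q.mul_mem_left (θ' (f (algebraMap R _ b1)) * θ' b) e2)
    convert this using 1
    simp only [RingHom.comp_apply, map_mul]
    ring
  intro b
  have hmem : θ b ∈ WSub R := by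
    refine ⟨hθint b, ?_⟩
    have := hall b
    rw [← RingHom.comp_assoc, hθ'f] at this
    exact this
  exact ⟨⟨θ b, hmem⟩, hθinj (hθf _)⟩

theorem WMem.push {A A' B B' : Type*} [CommRing A] [CommRing A'] [CommRing B] [CommRing B']
    {f : A →+* B} {f' : A' →+* B'} (k : A →+* A') (g : B →+* B') (hc : ∀ a, g (f a) = f' (k a))
    {x : B} (hx : WMem f x) : WMem f' (g x) := by
  intro p hp
  obtain ⟨a, b, hb, h⟩ := hx (p.comap k) (hp.comap k)
  refine ⟨k a, k b, hb, fun q hq hqp => ?_⟩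
  have := h (q.comap g) (hq.comap g) (by
    rw [← hqp, Ideal.comap_comap, Ideal.comap_comap]
    congr 1
    exact RingHom.ext hc)
  rw [Ideal.mem_comap, map_sub, map_mul, hc, hc] at this
  exact this

theorem seminormal_contains (T K : Type u) [CommRing T] [CommRing K] [Algebra T K]
    [IsFractionRing T K] (hsn : IsSeminormalRing T) (N : Subalgebra T K)
    (hN : N ≤ integralClosure T K) (w : N) (hw : WMem (algebraMap T N) w) :
    ∃ t, algebraMap T K t = w := by
  have hwint : IsIntegral T (w : K) := hN w.2
  obtain ⟨B, hB⟩ : ∃ B : Subalgebra T K, B = Algebra.adjoin T {(w : K)} := ⟨_, rfl⟩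
  have hfin : (algebraMap T B).Finite := by
    have : Module.Finite T B := hB ▸ Algebra.finite_adjoin_simple_of_isIntegral hwint
    exact RingHom.finite_algebraMap.2 this
  have hinj : Function.Injective (algebraMap T B) :=
    fun x y h => IsFractionRing.injective T K (congrArg (fun z : B => (z : K)) h)
  have hBN : B ≤ N := by
    rw [hB, Algebra.adjoin_le_iff]
    rintro _ rfl
    exact w.2
  have hgint : (Subalgebra.inclusion hBN).toRingHom.IsIntegral := by
    have h := algebraMap_isIntegral_of_le N hN
    rw [← (Subalgebra.inclusion hBN).comp_algebraMap] at h
    exact h.tower_top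
  have hwB : (w : K) ∈ B := hB ▸ Algebra.self_mem_adjoin_singleton T (w : K)
  have hwW : WMem (algebraMap T B) ⟨w, hwB⟩ :=
    WMem.descend (g := (Subalgebra.inclusion hBN).toRingHom)
      (Subalgebra.inclusion_injective hBN) hgint hw
  have hall : ∀ b : B, WMem (algebraMap T B) b := by
    subst hB
    rintro ⟨b, hb⟩
    induction hb using Algebra.adjoin_induction with
    | mem x hx => obtain rfl : x = w := hx; exact hwW
    | algebraMap r => exact WMem.map _ r
    | add x y hx hy h1 h2 => exact h1.add h2
    | mul x y hx hy h1 h2 => exact h1.mul h2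
  have hf2 : IsFractionRing B K :=
    isFractionRing_mid (R := T) (algebraMap T B) (fun r => rfl) Subtype.val_injective
  have := hsn B (algebraMap T B) hinj hfin
    (birational_of_mid (K := K) (algebraMap T B) (fun r => rfl))
    (comap_bijective_of_WMem hinj hfin.to_isIntegral hall) (by
      intro q hq
      refine (residue_surj_iff (algebraMap T B) q).2 ?_
      intro x
      obtain ⟨a, b, hb, h⟩ := hall x _ (hq.comap (algebraMap T B))
      exact ⟨a, b, hb, h q hq rfl⟩)
  obtain ⟨t, ht⟩ := this.2 ⟨w, hwB⟩
  exact ⟨t, congrArg (fun z : B => (z : K)) ht⟩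

theorem WSub_le (R : Type u) [CommRing R] (T : Subalgebra R (FractionRing R))
    (hsn : IsSeminormalRing T) : WSub R ≤ T := by
  rintro w ⟨hwN, hw⟩
  have hf1 : IsFractionRing T (FractionRing R) :=
    isFractionRing_mid (R := R) (algebraMap R T) (fun r => rfl) Subtype.val_injective
  have hle : ∀ x : integralClosure R (FractionRing R),
      (x : FractionRing R) ∈ integralClosure T (FractionRing R) :=
    fun x => IsIntegral.tower_top (R := R) x.2
  let g : integralClosure R (FractionRing R) →+* integralClosure T (FractionRing R) :=
    (integralClosure R (FractionRing R)).val.toRingHom.codRestrict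
      (integralClosure T (FractionRing R)) hle
  obtain ⟨t, ht⟩ := seminormal_contains T (FractionRing R) hsn (integralClosure T (FractionRing R))
    le_rfl (g ⟨w, hwN⟩) (WMem.push (A := R) (A' := T) (B := integralClosure R (FractionRing R))
      (B' := integralClosure T (FractionRing R)) (f' := algebraMap T _)
      (algebraMap R T) g (fun a => rfl) hw)
  have ht' : (t : FractionRing R) = w := ht
  rw [← ht']; exact t.2

theorem seminormalization_eq (R : Type u) [CommRing R] (S : Subalgebra R (FractionRing R))
    (hS : IsSeminormalization R S) : S = WSub R :=
  le_antisymm (hS.2.2 _ (fun _ hx => hx.1) (WSub_isSeminormal R)) (WSub_le R S hS.2.1)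

theorem WSub_WMem (A : Type u) [CommRing A] (w : WSub A) : WMem (algebraMap A (WSub A)) w := by
  have hW : WSub A ≤ integralClosure A (FractionRing A) := fun x hx => hx.1
  refine WMem.descend (g := (Subalgebra.inclusion hW).toRingHom)
    (Subalgebra.inclusion_injective hW) (inclusion_isIntegral (WSub A) hW) ?_
  exact w.2.2

theorem core2 {A : Type u} {B F : Type*} [CommRing A] [CommRing B] [CommRing F] [Algebra B F]
    (hBF : Function.Injective (algebraMap B F)) (h : A →+* B)
    (j : WSub A →+* F) (hj : ∀ a, j (algebraMap A (WSub A) a) = algebraMap B F (h a))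
    (x : B) (s : WSub A) (hs : j s = algebraMap B F x) : WMem h x := by
  intro p hp
  obtain ⟨a, b, hb, H⟩ := WSub_WMem A s p hp
  refine ⟨a, b, hb, fun q hq hqp => ?_⟩
  have hjint : ∀ w, j w ∈ integralClosure B F := by
    intro w
    obtain ⟨P, hP, h0⟩ := algebraMap_isIntegral_of_le (WSub A) (fun x hx => hx.1) w
    refine ⟨P.map h, hP.map h, ?_⟩
    rw [Polynomial.eval₂_map]
    have := congrArg j h0
    rw [Polynomial.hom_eval₂, map_zero] at this
    have hc : j.comp (algebraMap A (WSub A)) = (algebraMap B F).comp h := RingHom.ext hj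
    rw [← hc]
    exact this
  let j' : WSub A →+* integralClosure B F := j.codRestrict (integralClosure B F) hjint
  obtain ⟨q', hq', hqq⟩ := lyingOver (algebraMap B (integralClosure B F))
    (fun x y e => hBF (congrArg Subtype.val e))
    (algebraMap_isIntegral_of_le (integralClosure B F) le_rfl) q hq
  have hc : j'.comp (algebraMap A (WSub A)) = (algebraMap B (integralClosure B F)).comp h :=
    RingHom.ext fun a => Subtype.ext (hj a)
  have h1 := H (q'.comap j') (hq'.comap j') (by
    rw [Ideal.comap_comap, hc, ← Ideal.comap_comap, hqq, hqp])
  rw [← hqq]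
  rw [Ideal.mem_comap] at h1 ⊢
  convert h1 using 1
  apply Subtype.ext
  change algebraMap B F _ = j _
  rw [map_sub, map_mul, map_sub, map_mul, hj, hj, hs]

/-- A root relation descends along fractions. -/
theorem eval_frac {A B K : Type*} [CommRing A] [CommRing B] [CommRing K] [Algebra A K]
    (h : A →+* B) (hinj : Function.Injective h) (x : B) (a b : A) (hx : h b * x = h a)
    (s : K) (hb : IsUnit (algebraMap A K b)) (hs : algebraMap A K b * s = algebraMap A K a)
    (P : Polynomial A) (hP : P.eval₂ h x = 0) : P.eval₂ (algebraMap A K) s = 0 := by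
  have h1 := Polynomial.scaleRoots_eval₂_mul (p := P) h x b
  rw [hP, mul_zero, hx, Polynomial.eval₂_hom, map_eq_zero_iff h hinj] at h1
  have h2 := Polynomial.scaleRoots_eval₂_mul (p := P) (algebraMap A K) s b
  rw [hs, Polynomial.eval₂_hom, h1, map_zero] at h2
  exact ((hb.pow _).mul_right_eq_zero).1 h2.symm

theorem exists_frac {A B : Type*} [CommRing A] [CommRing B] [IsReduced A] [IsNoetherianRing A]
    [IsReduced B] (h : A →+* B) (x : B) (hx : WMem h x) :
    ∃ a b : A, b ∈ nonZeroDivisors A ∧ h b * x = h a := by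
  let I : Ideal A := 
    { carrier := {b | ∃ a, h b * x = h a}
      add_mem' := by
        rintro b b' ⟨a, ha⟩ ⟨a', ha'⟩
        exact ⟨a + a', by rw [map_add, map_add, add_mul, ha, ha']⟩
      zero_mem' := ⟨0, by simp⟩
      smul_mem' := by
        rintro c b ⟨a, ha⟩
        exact ⟨c * a, by rw [smul_eq_mul, map_mul, map_mul, mul_assoc, ha]⟩ }
  have hI : ∀ p ∈ minimalPrimes A, ¬ I ≤ p := by
    intro p hp hle
    have hpp : p.IsPrime := hp.1.1
    obtain ⟨a, b, hb, H⟩ := hx p hpp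
    set y := h b * x - h a with hy
    have key : ∃ d, d ∉ p ∧ h d * y = 0 := by
      by_contra hcon
      push Not at hcon
      let M : Submonoid B := (p.primeCompl.map h) ⊔ Submonoid.powers y
      have hM : Disjoint ((⊥ : Ideal B) : Set B) M := by
        rw [Set.disjoint_left]
        rintro z hz hzM
        have hz0 : z = 0 := hz
        subst hz0
        obtain ⟨u, hu, v, hv, huv⟩ := Submonoid.mem_sup.1 hzM
        obtain ⟨d, hd, rfl⟩ := hu
        obtain ⟨n, rfl⟩ := hv
        apply hcon d hd
        apply IsReduced.eq_zero
        refine ⟨n + 1, ?_⟩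
        have : h d * y ^ n = 0 := huv
        calc (h d * y) ^ (n + 1) = (h d * y ^ n) * (h d ^ n * y) := by ring
          _ = 0 := by rw [this, zero_mul]
      obtain ⟨q, hq, -, hdis⟩ := Ideal.exists_le_prime_disjoint (⊥ : Ideal B) M hM
      have hqp : q.comap h ≤ p := by
        intro d hd
        by_contra hdp
        exact Set.disjoint_left.1 hdis hd
          ((le_sup_left : _ ≤ M) ⟨d, hdp, rfl⟩)
      have hqp' : q.comap h = p := le_antisymm hqp (hp.2 ⟨hq.comap h, bot_le⟩ hqp)
      exact Set.disjoint_left.1 hdis (H q hq hqp')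
        ((le_sup_right : _ ≤ M) (Submonoid.mem_powers y))
    obtain ⟨d, hd, hdy⟩ := key
    have : d * b ∈ I := ⟨d * a, by
      rw [hy, mul_sub, sub_eq_zero] at hdy
      rw [map_mul, map_mul, mul_assoc, hdy]⟩
    exact (hpp.mem_or_mem (hle this)).elim hd hb
  have hfin : (minimalPrimes A).Finite := minimalPrimes.finite_of_isNoetherianRing A
  have hnot : ¬ ((I : Set A) ⊆ ⋃ p ∈ minimalPrimes A, ((id p : Ideal A) : Set A)) := by
    rw [Ideal.subset_union_prime_finite hfin (f := id) ⊥ ⊥ (fun p hp _ _ => hp.1.1)]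
    rintro ⟨p, hp, hle⟩
    exact hI p hp hle
  obtain ⟨b, hbI, hb⟩ := Set.not_subset.1 hnot
  obtain ⟨a, ha⟩ := hbI
  refine ⟨a, b, ?_, ha⟩
  rw [mem_nonZeroDivisors_iff_right]
  intro z hz
  simp only [Set.mem_iUnion, not_exists, id] at hb
  have : z ∈ sInf (minimalPrimes A) := by
    rw [Submodule.mem_sInf]
    intro p hp
    have h0 : z * b ∈ p := by rw [hz]; exact p.zero_mem
    exact (hp.1.1.mem_or_mem h0).resolve_right (hb p hp)
  rw [minimalPrimes, Ideal.sInf_minimalPrimes] at this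
  obtain ⟨n, hn⟩ := this
  exact IsReduced.eq_zero _ ⟨n, hn⟩

theorem core1 {A : Type u} {B F : Type*} [CommRing A] [CommRing B] [CommRing F] [Algebra B F]
    [IsReduced A] [IsNoetherianRing A] [IsReduced B] [IsReduced F]
    (h : A →+* B) (hinj : Function.Injective h) (hintg : h.IsIntegral)
    (j : WSub A →+* F) (hj : ∀ a, j (algebraMap A (WSub A) a) = algebraMap B F (h a))
    (x : B) (hx : WMem h x) : ∃ s, j s = algebraMap B F x := by
  obtain ⟨a, b, hb, hab⟩ := exists_frac h x hx
  let s : FractionRing A := IsLocalization.mk' (FractionRing A) a (⟨b, hb⟩ : nonZeroDivisors A)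
  have hs : algebraMap A (FractionRing A) b * s = algebraMap A (FractionRing A) a :=
    IsLocalization.mk'_spec' (FractionRing A) a (⟨b, hb⟩ : nonZeroDivisors A)
  have hbu : IsUnit (algebraMap A (FractionRing A) b) :=
    IsLocalization.map_units (FractionRing A) (⟨b, hb⟩ : nonZeroDivisors A)
  have hev := eval_frac (K := FractionRing A) h hinj x a b hab s hbu hs
  have hsint : s ∈ integralClosure A (FractionRing A) := by
    obtain ⟨P, hP, h0⟩ := hintg x
    exact ⟨P, hP, hev P h0⟩
  -- polynomial evaluation maps
  let ex : Polynomial A →+* B := Polynomial.eval₂RingHom h x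
  let es : Polynomial A →+* integralClosure A (FractionRing A) :=
    Polynomial.eval₂RingHom (algebraMap A _) ⟨s, hsint⟩
  have hker : ∀ P ∈ RingHom.ker ex, es P = 0 := by
    intro P hP
    have h0 : P.eval₂ h x = 0 := hP
    have h1 := hev P h0
    apply Subtype.ext
    change (integralClosure A (FractionRing A)).val.toRingHom (P.eval₂ _ _) = 0
    rw [Polynomial.hom_eval₂]
    exact h1
  let g : ex.range →+* integralClosure A (FractionRing A) :=
    (Ideal.Quotient.lift (RingHom.ker ex) es hker).comp
      (RingHom.quotientKerEquivRange ex).symm.toRingHom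
  have hg : ∀ P, g (ex.rangeRestrict P) = es P := by
    intro P
    have : (RingHom.quotientKerEquivRange ex).symm (ex.rangeRestrict P)
        = Ideal.Quotient.mk _ P := by
      rw [RingEquiv.symm_apply_eq]; rfl
    change (Ideal.Quotient.lift (RingHom.ker ex) es hker)
      ((RingHom.quotientKerEquivRange ex).symm (ex.rangeRestrict P)) = _
    rw [this, Ideal.Quotient.lift_mk]
  have hsubint : ex.range.subtype.IsIntegral := by
    have : h = ex.range.subtype.comp (ex.rangeRestrict.comp Polynomial.C) := by
      ext r
      simp [ex]
    rw [this] at hintg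
    exact hintg.tower_top
  have hstrong : ∀ (p : Ideal A) (a' b' : A),
      (∀ q : Ideal B, q.IsPrime → q.comap h = p → h b' * x - h a' ∈ q) →
      ∀ Q : Ideal (integralClosure A (FractionRing A)), Q.IsPrime →
        Q.comap (algebraMap A _) = p →
        algebraMap A (integralClosure A (FractionRing A)) b' * ⟨s, hsint⟩ - algebraMap A _ a' ∈ Q := by
    intro p a' b' H Q hQ hQp
    obtain ⟨q, hq, hqQ⟩ := lyingOver ex.range.subtype Subtype.val_injective hsubint
      (Q.comap g) (hQ.comap g)
    have hCg : algebraMap A (integralClosure A (FractionRing A))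
        = g.comp (ex.rangeRestrict.comp Polynomial.C) := by
      apply RingHom.ext
      intro r
      simp only [RingHom.comp_apply]
      rw [hg]
      simp [es]
    have hCh : h = ex.range.subtype.comp (ex.rangeRestrict.comp Polynomial.C) := by
      ext r
      simp [ex]
    have h1 := H q hq (by
      rw [← hQp, hCg, ← Ideal.comap_comap, ← hqQ, Ideal.comap_comap, ← hCh])
    let P : Polynomial A := Polynomial.C b' * Polynomial.X - Polynomial.C a'
    have h2 : ex.rangeRestrict P ∈ q.comap ex.range.subtype := by
      rw [Ideal.mem_comap]
      convert h1 using 1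
      simp [P, ex]
    rw [hqQ, Ideal.mem_comap, hg] at h2
    convert h2 using 1
    simp [P, es]
  have hsW : s ∈ WSub A := by
    refine ⟨hsint, ?_⟩
    intro p hp
    obtain ⟨a', b', hb', H⟩ := hx p hp
    exact ⟨a', b', hb', hstrong p a' b' H⟩
  refine ⟨⟨s, hsW⟩, ?_⟩
  rw [← sub_eq_zero]
  apply IsReduced.eq_zero
  rw [nilpotent_iff_mem_prime]
  intro q hq
  have hq1 := hq.comap (algebraMap B F)
  obtain ⟨a', b', hb', H⟩ := hx _ (hq1.comap h)
  have hW : WSub A ≤ integralClosure A (FractionRing A) := fun x hx => hx.1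
  obtain ⟨Q, hQ, hQq⟩ := lyingOver (Subalgebra.inclusion hW).toRingHom
    (Subalgebra.inclusion_injective hW) (inclusion_isIntegral (WSub A) hW)
    (q.comap j) (hq.comap j)
  have hjc : j.comp (algebraMap A (WSub A)) = (algebraMap B F).comp h := RingHom.ext hj
  have h1 := hstrong _ a' b' H Q hQ (by
    have : algebraMap A (integralClosure A (FractionRing A)) =
        (Subalgebra.inclusion hW).toRingHom.comp (algebraMap A (WSub A)) := rfl
    rw [this, ← Ideal.comap_comap, hQq, Ideal.comap_comap, hjc, Ideal.comap_comap])
  have h2 : algebraMap A (WSub A) b' * ⟨s, hsW⟩ - algebraMap A (WSub A) a' ∈ q.comap j := by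
    rw [← hQq]; exact h1
  have h3 := H _ hq1 rfl
  rw [Ideal.mem_comap] at h2 h3
  simp only [map_sub, map_mul, hj] at h2 h3
  have h4 := q.sub_mem h2 h3
  have h5 : algebraMap B F (h b') * (j ⟨s, hsW⟩ - algebraMap B F x) ∈ q := by
    convert h4 using 1; ring
  exact (hq.mem_or_mem h5).resolve_left hb'

theorem conductor_iff (R : Type u) [CommRing R] (t : R) : t ∈ conductorIdeal R ↔
    ∀ x : integralClosure R (FractionRing R),
      ∃ r : R, algebraMap R (integralClosure R (FractionRing R)) r = algebraMap R _ t * x := by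
  rw [conductorIdeal, Module.mem_annihilator]
  constructor
  · intro h x
    have := h (Submodule.Quotient.mk x)
    rw [← Submodule.Quotient.mk_smul, Submodule.Quotient.mk_eq_zero] at this
    obtain ⟨r, hr⟩ := this
    exact ⟨r, by rw [← Algebra.smul_def]; exact hr⟩
  · intro h m
    obtain ⟨x, rfl⟩ := Submodule.Quotient.mk_surjective _ m
    rw [← Submodule.Quotient.mk_smul, Submodule.Quotient.mk_eq_zero]
    obtain ⟨r, hr⟩ := h x
    exact ⟨r, by rw [Algebra.smul_def]; exact hr⟩

theorem conductor_map (R : Type u) [CommRing R] (y : integralClosure R (FractionRing R))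
    (hy : y ∈ (conductorIdeal R).map (algebraMap R (integralClosure R (FractionRing R)))) :
    ∀ x, ∃ r : R, algebraMap R (integralClosure R (FractionRing R)) r = y * x := by
  induction hy using Submodule.span_induction with
  | mem y hy =>
    obtain ⟨t, ht, rfl⟩ := hy
    exact (conductor_iff R t).1 ht
  | zero => exact fun x => ⟨0, by simp⟩
  | add y z _ _ h1 h2 =>
    intro x
    obtain ⟨r, hr⟩ := h1 x
    obtain ⟨r', hr'⟩ := h2 x
    exact ⟨r + r', by rw [map_add, hr, hr', add_mul]⟩
  | smul a y _ h1 =>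
    intro x
    obtain ⟨r, hr⟩ := h1 (a * x)
    exact ⟨r, by rw [hr, smul_eq_mul]; ring⟩

theorem condQuotMap_injective (R : Type u) [CommRing R] : Function.Injective (condQuotMap R) := by
  rw [injective_iff_map_eq_zero]
  intro a ha
  obtain ⟨r, rfl⟩ : ∃ r, aQuotMk R r = a := Ideal.Quotient.mk_surjective a
  have h1 : nQuotMk R (algebraMap R _ r) = 0 := ha
  have h2 : algebraMap R _ r ∈ ((conductorIdeal R).map
      (algebraMap R ↥(integralClosure R (FractionRing R)))).radical :=
    Ideal.Quotient.eq_zero_iff_mem.1 h1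
  obtain ⟨n, hn⟩ := h2
  rw [← map_pow] at hn
  have h3 : r ^ n ∈ conductorIdeal R := (conductor_iff R _).2 (conductor_map R _ hn)
  exact Ideal.Quotient.eq_zero_iff_mem.2 ⟨n, h3⟩

theorem nQuotMk_surjective (R : Type u) [CommRing R] : Function.Surjective (nQuotMk R) :=
  Ideal.Quotient.mk_surjective

theorem aQuotMk_surjective (R : Type u) [CommRing R] : Function.Surjective (aQuotMk R) :=
  Ideal.Quotient.mk_surjective

theorem condQuotMap_mk (R : Type u) [CommRing R] (r : R) :
    condQuotMap R (aQuotMk R r) = nQuotMk R (algebraMap R _ r) := rfl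

theorem condQuotMap_isIntegral (R : Type u) [CommRing R] : (condQuotMap R).IsIntegral := by
  have h1 : ((nQuotMk R).comp (algebraMap R (integralClosure R (FractionRing R)))).IsIntegral :=
    RingHom.IsIntegral.trans _ _ (algebraMap_isIntegral_of_le _ le_rfl)
      (RingHom.isIntegral_of_surjective _ (nQuotMk_surjective R))
  have h2 : (nQuotMk R).comp (algebraMap R (integralClosure R (FractionRing R))) =
      (condQuotMap R).comp (aQuotMk R) := rfl
  rw [h2] at h1
  exact h1.tower_top

theorem aQuot_reduced (R : Type u) [CommRing R] : IsReduced (AQuot R) :=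
  (Ideal.isRadical_iff_quotient_reduced _).1 (Ideal.radical_isRadical _)

theorem nQuot_reduced (R : Type u) [CommRing R] : IsReduced (NQuot R) :=
  (Ideal.isRadical_iff_quotient_reduced _).1 (Ideal.radical_isRadical _)

theorem aQuot_noeth (R : Type u) [CommRing R] [IsNoetherianRing R] : IsNoetherianRing (AQuot R) :=
  isNoetherianRing_of_surjective _ _ (aQuotMk R) (aQuotMk_surjective R)

theorem WMem_of_quot (R : Type u) [CommRing R] (x : integralClosure R (FractionRing R))
    (hx : WMem (condQuotMap R) (nQuotMk R x)) :
    WMem (algebraMap R (integralClosure R (FractionRing R))) x := by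
  intro p hp
  by_cases hc : conductorIdeal R ≤ p
  · have hkerA : RingHom.ker (aQuotMk R) ≤ p := by
      intro r hr
      have : r ∈ (conductorIdeal R).radical := Ideal.Quotient.eq_zero_iff_mem.1 hr
      exact (Ideal.IsPrime.radical_le_iff hp).2 hc this
    have hpA : (p.map (aQuotMk R)).IsPrime :=
      Ideal.map_isPrime_of_surjective (aQuotMk_surjective R) hkerA
    have hcomap : (p.map (aQuotMk R)).comap (aQuotMk R) = p := by
      rw [Ideal.comap_map_of_surjective' _ (aQuotMk_surjective R)]
      exact sup_eq_left.2 hkerA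
    obtain ⟨a, b, hb, H⟩ := hx _ hpA
    obtain ⟨a, rfl⟩ := aQuotMk_surjective R a
    obtain ⟨b, rfl⟩ := aQuotMk_surjective R b
    refine ⟨a, b, fun h => hb (Ideal.mem_map_of_mem _ h), fun q hq hqp => ?_⟩
    have hkerN : RingHom.ker (nQuotMk R) ≤ q := by
      intro r hr
      have : r ∈ ((conductorIdeal R).map
        (algebraMap R (integralClosure R (FractionRing R)))).radical :=
          Ideal.Quotient.eq_zero_iff_mem.1 hr
      refine (Ideal.IsPrime.radical_le_iff hq).2 ?_ this
      rw [Ideal.map_le_iff_le_comap, hqp]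
      exact hc
    have hqN : (q.map (nQuotMk R)).IsPrime :=
      Ideal.map_isPrime_of_surjective (nQuotMk_surjective R) hkerN
    have hcomapN : (q.map (nQuotMk R)).comap (nQuotMk R) = q := by
      rw [Ideal.comap_map_of_surjective' _ (nQuotMk_surjective R)]
      exact sup_eq_left.2 hkerN
    have h1 := H _ hqN (by
      apply Ideal.comap_injective_of_surjective _ (aQuotMk_surjective R)
      rw [hcomap, Ideal.comap_comap]
      have h2 : (condQuotMap R).comp (aQuotMk R) =
        (nQuotMk R).comp (algebraMap R (integralClosure R (FractionRing R))) := rfl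
      rw [h2, ← Ideal.comap_comap, hcomapN, hqp])
    rw [condQuotMap_mk, condQuotMap_mk, ← map_mul, ← map_sub, ← Ideal.mem_comap, hcomapN] at h1
    exact h1
  · obtain ⟨t, ht, htp⟩ := SetLike.not_le_iff_exists.1 hc
    obtain ⟨r, hr⟩ := (conductor_iff R t).1 ht x
    exact ⟨r, t, htp, fun q _ _ => by rw [hr, sub_self]; exact q.zero_mem⟩

theorem main_iff (R : Type u) [CommRing R] [IsNoetherianRing R]
    (j : ↥(WSub (AQuot R)) →+* FractionRing (NQuot R))
    (hjcomp : ∀ a : AQuot R,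
      j (algebraMap (AQuot R) ↥(WSub (AQuot R)) a) =
        algebraMap (NQuot R) (FractionRing (NQuot R)) (condQuotMap R a))
    (x : integralClosure R (FractionRing R)) :
    WMem (algebraMap R (integralClosure R (FractionRing R))) x ↔
      ∃ s, j s = algebraMap (NQuot R) (FractionRing (NQuot R)) (nQuotMk R x) := by
  have := aQuot_reduced R
  have := nQuot_reduced R
  have := aQuot_noeth R
  have : IsReduced (FractionRing (NQuot R)) :=
    isReduced_localizationPreserves (nonZeroDivisors (NQuot R)) _ inferInstance
  constructor
  · intro hx
    exact core1 (condQuotMap R) (condQuotMap_injective R) (condQuotMap_isIntegral R) j hjcomp _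
      (WMem.push (aQuotMk R) (nQuotMk R) (fun a => rfl) hx)
  · rintro ⟨s, hs⟩
    exact WMem_of_quot R x (core2 (IsFractionRing.injective (NQuot R) (FractionRing (NQuot R)))
      (condQuotMap R) j hjcomp _ s hs)

end helpers

/-- (Theorem: the pullback is the seminormalization.)
Let `R` be reduced Noetherian with module-finite normalization `R^N` and conductor `c`.
Let `S_R` be the seminormalization of `R`, let `S_A` be the seminormalization of
`A = R/√(cR)`, embedded via `j` into the total ring of fractions of `B = R^N/√(c R^N)`
compatibly with the natural map `A → B`.  Let `D` be the intersection of `S_A` with `B`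
inside `Frac(B)` (realized as the subring of `B` of elements whose image lies in `S_A`),
and let `C` be the pullback of `R^N → B ← D`.  Then `C` is the seminormalization of `R`:
there is a ring isomorphism `S_R ≃ C` compatible with the maps from `R`. -/
theorem statement0 (R : Type) [CommRing R] [IsReduced R] [IsNoetherianRing R]
    [Module.Finite R ↥(integralClosure R (FractionRing R))]
    (SR : Subalgebra R (FractionRing R)) (hSR : IsSeminormalization R SR)
    (SA : Subalgebra (AQuot R) (FractionRing (AQuot R)))
    (hSA : IsSeminormalization (AQuot R) SA)
    (j : ↥SA →+* FractionRing (NQuot R)) (hjinj : Function.Injective j)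
    (hjcomp : ∀ a : AQuot R,
      j (algebraMap (AQuot R) ↥SA a) =
        algebraMap (NQuot R) (FractionRing (NQuot R)) (condQuotMap R a)) :
    ∀ D : Subring (NQuot R),
      D = Subring.comap (algebraMap (NQuot R) (FractionRing (NQuot R)))
        (RingHom.range (R := ↥SA) (S := FractionRing (NQuot R)) j) →
    ∀ C : Subring (↥(integralClosure R (FractionRing R)) × ↥D),
      C = ringPullback (nQuotMk R) D.subtype →
    ∃ e : ↥SR ≃+* ↥C,
      ∀ r : R, (e (algebraMap R ↥SR r)).1.1 =
        algebraMap R ↥(integralClosure R (FractionRing R)) r := by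
  obtain rfl := seminormalization_eq R SR hSR
  obtain rfl := seminormalization_eq (AQuot R) SA hSA
  intro D hD C hC
  have hiff := main_iff R j hjcomp
  have hmemD : ∀ y : NQuot R, y ∈ D ↔ ∃ s, j s = algebraMap (NQuot R) (FractionRing (NQuot R)) y := by
    intro y
    rw [hD]
    exact Iff.rfl
  have hmemC : ∀ z : ↥(integralClosure R (FractionRing R)) × ↥D, z ∈ C ↔ nQuotMk R z.1 = z.2 := by
    intro z
    rw [hC]
    exact Iff.rfl
  let f : ↥(WSub R) → ↥C := fun w =>
    ⟨(⟨w.1, w.2.1⟩, ⟨nQuotMk R ⟨w.1, w.2.1⟩, (hmemD _).2 ((hiff _).1 w.2.2)⟩),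
      (hmemC _).2 rfl⟩
  have hf : Function.Bijective f := by
    constructor
    · intro w w' h
      have h1 : (f w).1.1.1 = (f w').1.1.1 := by rw [h]
      exact Subtype.ext h1
    · rintro ⟨⟨x, d⟩, hz⟩
      have hxd : nQuotMk R x = d := (hmemC _).1 hz
      have hx := (hiff x).2 ((hmemD _).1 (hxd ▸ d.2))
      refine ⟨⟨x.1, x.2, hx⟩, ?_⟩
      apply Subtype.ext
      apply Prod.ext
      · rfl
      · exact Subtype.ext hxd
  let F : ↥(WSub R) →+* ↥C :=
    { toFun := f
      map_one' := by
        apply Subtype.ext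
        apply Prod.ext
        · rfl
        · exact Subtype.ext (map_one (nQuotMk R))
      map_zero' := by
        apply Subtype.ext
        apply Prod.ext
        · rfl
        · exact Subtype.ext (map_zero (nQuotMk R))
      map_add' := fun w w' => by
        apply Subtype.ext
        apply Prod.ext
        · rfl
        · exact Subtype.ext (map_add (nQuotMk R) ⟨w.1, w.2.1⟩ ⟨w'.1, w'.2.1⟩)
      map_mul' := fun w w' => by
        apply Subtype.ext
        apply Prod.ext
        · rfl
        · exact Subtype.ext (map_mul (nQuotMk R) ⟨w.1, w.2.1⟩ ⟨w'.1, w'.2.1⟩) }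
  exact ⟨RingEquiv.ofBijective F hf, fun r => rfl⟩
end

section
/- Let R be a reduced Noetherian ring whose normalization R^N is module-finite over R, with conductor c = Ann_R(R^N/R). Let β : R^SN → (R/√(c R))^SN be the map induced by functoriality of seminormalization applied to the surjection R → R/√(c R). Then the image of β lies in D = (R/√(c R))^SN ∩ (R^N/√(c R^N)) (intersection taken in the total ring of fractions of R^N/√(c R^N)); consequently, by the universal property of the pullback, there is an induced ring homomorphism from R^SN to the pullback C of R^N → R^N/√(c R^N) ← D. -/
universe u v

set_option synthInstance.maxHeartbeats 1000000
set_option maxHeartbeats 1000000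

open IsLocalRing in
/-- Two maps to a field agreeing on `A` agree on a subintegral extension `B`. -/
theorem subint_eq {A B L : Type} [CommRing A] [CommRing B] [Field L] (f : A →+* B)
    (hs : Function.Injective (PrimeSpectrum.comap f)) (hr : InducesResidueFieldIsos f)
    (u v : B →+* L) (huv : ∀ a, u (f a) = v (f a)) : u = v := by
  have hker : RingHom.ker u = RingHom.ker v := by
    have := @hs ⟨RingHom.ker u, RingHom.ker_isPrime u⟩ ⟨RingHom.ker v, RingHom.ker_isPrime v⟩ (by
      ext a
      simp [RingHom.mem_ker, huv])
    exact congrArg PrimeSpectrum.asIdeal this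
  ext b
  have : (RingHom.ker u).IsPrime := RingHom.ker_isPrime u
  obtain ⟨x, hx⟩ := (hr (RingHom.ker u)).2
    (residue _ (algebraMap B (Localization.AtPrime (RingHom.ker u)) b))
  obtain ⟨y, rfl⟩ := residue_surjective x
  obtain ⟨a, s, rfl⟩ := IsLocalization.exists_mk'_eq ((RingHom.ker u).comap f).primeCompl y
  rw [ResidueField.map_residue, Localization.localRingHom_mk', ← sub_eq_zero, ← map_sub,
    residue_eq_zero_iff] at hx
  have h2 : algebraMap B (Localization.AtPrime (RingHom.ker u)) (f a - f s * b) ∈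
      maximalIdeal (Localization.AtPrime (RingHom.ker u)) := by
    have := Ideal.mul_mem_left _
      (algebraMap B (Localization.AtPrime (RingHom.ker u)) (f s)) hx
    rw [mul_sub] at this
    have h0 : ∀ w : (RingHom.ker u).primeCompl,
        algebraMap B (Localization.AtPrime (RingHom.ker u)) w *
          IsLocalization.mk' (Localization.AtPrime (RingHom.ker u)) (f a) w =
        algebraMap B (Localization.AtPrime (RingHom.ker u)) (f a) := fun w =>
      IsLocalization.mk'_spec' _ _ _
    rw [map_sub, map_mul]
    have h1 := h0 ⟨f s, s.2⟩
    rw [← h1]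
    exact this
  rw [IsLocalization.AtPrime.to_map_mem_maximal_iff _ (RingHom.ker u)] at h2
  have h3 : f a - f s * b ∈ RingHom.ker v := hker ▸ h2
  rw [RingHom.mem_ker, map_sub, map_mul, sub_eq_zero] at h2 h3
  have hne : u (f s) ≠ 0 := fun h => s.2 (by simpa [RingHom.mem_ker] using h)
  apply mul_left_cancel₀ hne
  rw [← h2, huv, huv, h3]

/-- Extension of maps into algebraically closed fields along integral extensions. -/
theorem exists_ext_algClosed {A B L : Type} [CommRing A] [CommRing B] [Field L] [IsAlgClosed L]
    [Algebra A B] [Algebra.IsIntegral A B] (hi : Function.Injective (algebraMap A B))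
    (f : A →+* L) : ∃ g : B →+* L, ∀ a, g (algebraMap A B a) = f a := by
  have : (RingHom.ker f).IsPrime := RingHom.ker_isPrime f
  obtain ⟨Q, -, hQ, hQp⟩ := Ideal.exists_ideal_over_prime_of_isIntegral (S := B)
    (RingHom.ker f) ⊥ (by
      intro x hx
      have : x = 0 := hi (by simpa using hx)
      simp [this])
  have : Q.LiesOver (RingHom.ker f) := ⟨hQp.symm⟩
  let f' : A ⧸ RingHom.ker f →+* L := RingHom.kerLift f
  let : Algebra (A ⧸ RingHom.ker f) L := f'.toAlgebra
  have : FaithfulSMul (A ⧸ RingHom.ker f) L :=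
    (faithfulSMul_iff_algebraMap_injective _ _).2 (RingHom.kerLift_injective f)
  have : Module.IsTorsionFree (A ⧸ RingHom.ker f) L := inferInstance
  have : Module.IsTorsionFree (A ⧸ RingHom.ker f) (B ⧸ Q) := inferInstance
  have : Algebra.IsIntegral (A ⧸ RingHom.ker f) (B ⧸ Q) := inferInstance
  let g : B ⧸ Q →ₐ[A ⧸ RingHom.ker f] L := IsAlgClosed.lift
  refine ⟨g.toRingHom.comp (Ideal.Quotient.mk Q), fun a => ?_⟩
  exact g.commutes (Ideal.Quotient.mk _ a)

/-- The weak-normalization-like subalgebra. -/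
noncomputable def weakSub (R : Type) [CommRing R] : Subalgebra R (FractionRing R) where
  carrier := {x | ∃ h : x ∈ integralClosure R (FractionRing R),
    ∀ (L : Type) [Field L] [IsAlgClosed L]
      (u v : ↥(integralClosure R (FractionRing R)) →+* L),
      (∀ r : R, u (algebraMap R _ r) = v (algebraMap R _ r)) → u ⟨x, h⟩ = v ⟨x, h⟩}
  mul_mem' := by
    rintro x y ⟨hx, hx'⟩ ⟨hy, hy'⟩
    refine ⟨mul_mem hx hy, fun L _ _ u v huv => ?_⟩
    have := congrArg₂ (· * ·) (hx' L u v huv) (hy' L u v huv)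
    simp only [← map_mul] at this
    exact this
  add_mem' := by
    rintro x y ⟨hx, hx'⟩ ⟨hy, hy'⟩
    refine ⟨add_mem hx hy, fun L _ _ u v huv => ?_⟩
    have := congrArg₂ (· + ·) (hx' L u v huv) (hy' L u v huv)
    simp only [← map_add] at this
    exact this
  algebraMap_mem' r := ⟨Subalgebra.algebraMap_mem _ r, fun L _ _ u v huv => huv r⟩

theorem isUnit_of_nzd_sub {R : Type} [CommRing R] (T : Subalgebra R (FractionRing R))
    (t : T) (ht : t ∈ nonZeroDivisors T) : IsUnit (t : FractionRing R) := by
  obtain ⟨a, s, hs⟩ := IsLocalization.exists_mk'_eq (nonZeroDivisors R) (t : FractionRing R)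
  have h1 : (t : FractionRing R) * algebraMap R (FractionRing R) s
      = algebraMap R (FractionRing R) a := by
    rw [← hs, IsLocalization.mk'_spec]
  have ha : a ∈ nonZeroDivisors R := by
    rw [mem_nonZeroDivisors_iff_right]
    intro r hr
    have h2 : algebraMap R T (r * s) * t = 0 := by
      apply Subtype.ext
      change algebraMap R (FractionRing R) (r * s) * (t : FractionRing R) = 0
      rw [map_mul, mul_assoc, mul_comm (algebraMap R (FractionRing R) s), h1, ← map_mul, hr,
        map_zero]
    have h3 := (mem_nonZeroDivisors_iff_right.1 ht) _ h2
    have h4 : algebraMap R (FractionRing R) (r * s) = 0 := congrArg Subtype.val h3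
    have h5 : r * s = 0 := IsFractionRing.injective R (FractionRing R) (by rw [h4, map_zero])
    exact (mem_nonZeroDivisors_iff_right.1 s.2) _ h5
  have hu : IsUnit (algebraMap R (FractionRing R) a) :=
    IsLocalization.map_units (FractionRing R) (⟨a, ha⟩ : nonZeroDivisors R)
  rw [← h1] at hu
  exact isUnit_of_mul_isUnit_left hu

theorem weakSub_seminormal (R : Type) [CommRing R] : IsSeminormalRing (weakSub R) := by
  intro B _ f hf hfin ⟨hle, hbij⟩ hspec hres
  refine ⟨hf, fun b => ?_⟩
  set m := (IsLocalization.map (M := nonZeroDivisors (weakSub R)) (T := nonZeroDivisors B)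
        (FractionRing B) f hle : FractionRing (weakSub R) →+* FractionRing B) with hm
  let e : FractionRing (weakSub R) ≃+* FractionRing B := RingEquiv.ofBijective m hbij
  let l : FractionRing (weakSub R) →+* FractionRing R :=
    IsLocalization.lift (M := nonZeroDivisors (weakSub R)) (g := (weakSub R).val.toRingHom)
      (fun y => isUnit_of_nzd_sub (weakSub R) y y.2)
  let ι : B →+* FractionRing R :=
    (l.comp e.symm.toRingHom).comp (algebraMap B (FractionRing B))
  have hι : ∀ t, ι (f t) = (t : FractionRing R) := by
    intro t
    have h1 : e.symm (algebraMap B (FractionRing B) (f t)) =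
        algebraMap (weakSub R) (FractionRing (weakSub R)) t := by
      rw [RingEquiv.symm_apply_eq]
      exact (IsLocalization.map_eq hle t).symm
    change l (e.symm (algebraMap B (FractionRing B) (f t))) = _
    rw [h1]
    exact IsLocalization.lift_eq _ t
  have hTle : ∀ t : weakSub R, (t : FractionRing R) ∈ integralClosure R (FractionRing R) :=
    fun t => t.2.1
  have hint : ∀ b, ι b ∈ integralClosure R (FractionRing R) := by
    intro b
    have h1 : f.IsIntegralElem b := hfin.to_isIntegral b
    obtain ⟨p, hp, hp0⟩ := h1
    have h2 : IsIntegral (integralClosure R (FractionRing R)) (ι b) := by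
      refine ⟨p.map (Subalgebra.inclusion (show weakSub R ≤ integralClosure R _ from
        fun x hx => hx.1)).toRingHom, hp.map _, ?_⟩
      rw [Polynomial.eval₂_map]
      have h3 : (algebraMap (integralClosure R (FractionRing R)) (FractionRing R)).comp
          (Subalgebra.inclusion (show weakSub R ≤ integralClosure R _ from
            fun x hx => hx.1)).toRingHom = ι.comp f := by
        ext t
        exact (hι t).symm
      rw [h3, ← Polynomial.hom_eval₂, hp0, map_zero]
    exact isIntegral_trans (R := R) _ h2
  let ι' : B →+* integralClosure R (FractionRing R) :=
    ι.codRestrict (integralClosure R (FractionRing R)).toSubring hint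
  have hmem : ι b ∈ weakSub R := by
    refine ⟨hint b, fun L _ _ u v huv => ?_⟩
    have := subint_eq f hspec.1 hres (u.comp ι') (v.comp ι') (fun t => by
      obtain ⟨h1, h2⟩ := t.2
      have h3 : ι' (f t) = ⟨t, h1⟩ := Subtype.ext (hι t)
      simp only [RingHom.comp_apply, h3]
      exact h2 L u v huv)
    exact congrArg (fun k => k b) this
  refine ⟨⟨ι b, hmem⟩, ?_⟩
  obtain ⟨x, hx⟩ := hbij.2 (algebraMap B (FractionRing B) b)
  obtain ⟨a, s, rfl⟩ := IsLocalization.exists_mk'_eq (nonZeroDivisors (weakSub R)) x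
  rw [IsLocalization.map_mk', IsLocalization.mk'_eq_iff_eq_mul, ← map_mul] at hx
  have hx2 : f a = b * f s := IsFractionRing.injective B (FractionRing B) hx
  have h4 : a = ⟨ι b, hmem⟩ * s := by
    apply Subtype.ext
    have := congrArg ι hx2
    rw [map_mul, hι, hι] at this
    exact this
  rw [h4, map_mul] at hx2
  have h5 : f s ∈ nonZeroDivisors B := hle s.2
  exact (mul_cancel_right_mem_nonZeroDivisors h5).1 hx2

theorem agree_on_sub {R : Type} [CommRing R] (S : Subalgebra R (FractionRing R))
    (hS : S ≤ weakSub R) {K : Type} [CommRing K] [IsReduced K] (u v : S →+* K)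
    (huv : ∀ r : R, u (algebraMap R S r) = v (algebraMap R S r)) (s : S) : u s = v s := by
  rw [← sub_eq_zero]
  have hnil : u s - v s ∈ nilradical K := by
    rw [nilradical_eq_sInf, Submodule.mem_sInf]
    intro P hP
    replace hP : Ideal.IsPrime P := hP
    let L := AlgebraicClosure (FractionRing (K ⧸ P))
    let q : K →+* L := ((algebraMap (FractionRing (K ⧸ P)) L).comp
      (algebraMap (K ⧸ P) (FractionRing (K ⧸ P)))).comp (Ideal.Quotient.mk P)
    have hSN : S ≤ integralClosure R (FractionRing R) := fun x hx => (hS hx).1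
    let i := Subalgebra.inclusion hSN
    let : Algebra S (integralClosure R (FractionRing R)) := i.toRingHom.toAlgebra
    have : IsScalarTower R S (integralClosure R (FractionRing R)) :=
      IsScalarTower.of_algebraMap_eq (fun r => rfl)
    have : Algebra.IsIntegral S (integralClosure R (FractionRing R)) :=
      Algebra.IsIntegral.tower_top R
    have hi : Function.Injective (algebraMap S (integralClosure R (FractionRing R))) :=
      Subalgebra.inclusion_injective hSN
    obtain ⟨u', hu'⟩ := exists_ext_algClosed hi (q.comp u)
    obtain ⟨v', hv'⟩ := exists_ext_algClosed hi (q.comp v)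
    obtain ⟨h1, h2⟩ := hS s.2
    have h3 := h2 L u' v' (fun r => by
      have a1 := hu' (algebraMap R S r)
      have a2 := hv' (algebraMap R S r)
      rw [← IsScalarTower.algebraMap_apply] at a1 a2
      exact a1.trans ((congrArg q (huv r)).trans a2.symm))
    have h4 : q (u s) = q (v s) := (hu' s).symm.trans (h3.trans (hv' s))
    have h5 : Ideal.Quotient.mk P (u s) = Ideal.Quotient.mk P (v s) :=
      IsFractionRing.injective (K ⧸ P) (FractionRing (K ⧸ P))
        ((algebraMap (FractionRing (K ⧸ P)) L).injective h4)
    exact Ideal.Quotient.eq.1 h5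
  rw [nilradical_eq_zero] at hnil
  exact hnil

/-- With notation as in the seminormalization algorithm: `β` is the map
`R^SN → (R/√(cR))^SN` induced by functoriality of seminormalization from the surjection
`R → R/√(cR)`, and `j` embeds `(R/√(cR))^SN` into the total ring of fractions of
`B = R^N/√(c R^N)` compatibly with the induced map `R/√(cR) → B`.  Then the image of `β`
lies in `D = (R/√(cR))^SN ∩ B` and, by the universal property of the pullback, there is an
induced ring homomorphism `R^SN → C` (compatible with the inclusions into `R^N`), where `C`
is the pullback of `R^N → B ← D`. -/
theorem statement2 (R : Type) [CommRing R] [IsReduced R] [IsNoetherianRing R]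
    [Module.Finite R ↥(integralClosure R (FractionRing R))]
    (SR : Subalgebra R (FractionRing R)) (hSR : IsSeminormalization R SR)
    (SA : Subalgebra (AQuot R) (FractionRing (AQuot R)))
    (hSA : IsSeminormalization (AQuot R) SA)
    (j : ↥SA →+* FractionRing (NQuot R)) (hjinj : Function.Injective j)
    (hjcomp : ∀ a : AQuot R,
      j (algebraMap (AQuot R) ↥SA a) =
        algebraMap (NQuot R) (FractionRing (NQuot R)) (condQuotMap R a))
    (β : ↥SR →+* ↥SA)
    (hβ : ∀ r : R, β (algebraMap R ↥SR r) = algebraMap (AQuot R) ↥SA (aQuotMk R r)) :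
    (∀ s : ↥SR,
      j (β s) ∈ RingHom.range (algebraMap (NQuot R) (FractionRing (NQuot R)))) ∧
    ∀ D : Subring (NQuot R),
      D = Subring.comap (algebraMap (NQuot R) (FractionRing (NQuot R)))
        (RingHom.range (R := ↥SA) (S := FractionRing (NQuot R)) j) →
    ∀ C : Subring (↥(integralClosure R (FractionRing R)) × ↥D),
      C = ringPullback (nQuotMk R) D.subtype →
    ∃ g : ↥SR →+* ↥C,
      ∀ s : ↥SR, ((g s).1.1 : FractionRing R) = (s : FractionRing R) := by
  have hle : SR ≤ weakSub R :=
    hSR.2.2 _ (fun x hx => hx.1) (weakSub_seminormal R)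
  have : IsReduced (NQuot R) :=
    (Ideal.isRadical_iff_quotient_reduced _).1 (Ideal.radical_isRadical _)
  have : IsReduced (FractionRing (NQuot R)) :=
    isReduced_localizationPreserves (nonZeroDivisors (NQuot R)) _ ‹IsReduced (NQuot R)›
  have key : ∀ s : ↥SR, j (β s) = algebraMap (NQuot R) (FractionRing (NQuot R))
      (nQuotMk R (Subalgebra.inclusion hSR.1 s)) := by
    intro s
    refine agree_on_sub SR hle (j.comp β)
      (((algebraMap (NQuot R) (FractionRing (NQuot R))).comp (nQuotMk R)).comp
        (Subalgebra.inclusion hSR.1).toRingHom) (fun r => ?_) s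
    rw [RingHom.comp_apply, hβ, hjcomp]
    rfl
  refine ⟨fun s => ⟨_, (key s).symm⟩, ?_⟩
  rintro D rfl C rfl
  let h : ↥SR →+* NQuot R := (nQuotMk R).comp (Subalgebra.inclusion hSR.1).toRingHom
  let hD : ↥SR →+* ↥(Subring.comap (algebraMap (NQuot R) (FractionRing (NQuot R)))
        (RingHom.range (R := ↥SA) (S := FractionRing (NQuot R)) j)) :=
    h.codRestrict _ (fun s => ⟨β s, key s⟩)
  exact ⟨((Subalgebra.inclusion hSR.1).toRingHom.prod hD).codRestrict _ (fun s => rfl),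
    fun s => rfl⟩
end

section
/- Let R be a reduced Noetherian ring whose normalization R^N is module-finite over R, with conductor c = Ann_R(R^N/R), let D = (R/√(c R))^SN ∩ (R^N/√(c R^N)), and let C be the pullback of R^N → R^N/√(c R^N) ← D. Then the induced ring homomorphism R^SN → C is a bijection on prime spectra and induces isomorphisms of all residue fields. -/
universe u v

set_option synthInstance.maxHeartbeats 1000000
set_option maxHeartbeats 1000000

/-- Elementwise form of subintegrality: over each prime `p`, every element of `B` takes a single
value in the residue field of `p` at all primes over `p`. -/
def ElemSub {A : Type u} {B : Type v} [CommRing A] [CommRing B] (f : A →+* B) : Prop :=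
  ∀ (p : Ideal A), p.IsPrime → ∀ b : B, ∃ a s : A, s ∉ p ∧
    ∀ Q : Ideal B, Q.IsPrime → Q.comap f = p → f s * b - f a ∈ Q

theorem ElemSub.comap_inj {A : Type u} {B : Type v} [CommRing A] [CommRing B] {f : A →+* B}
    (h : ElemSub f) (Q Q' : Ideal B) (hQ : Q.IsPrime) (hQ' : Q'.IsPrime)
    (e : Q.comap f = Q'.comap f) : Q = Q' := by
  have key : ∀ Q Q' : Ideal B, Q.IsPrime → Q'.IsPrime → Q.comap f = Q'.comap f → Q ≤ Q' := by
    intro Q Q' hQ hQ' e b hb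
    obtain ⟨a, s, hs, H⟩ := h (Q'.comap f) (hQ'.comap f) b
    have h1 := H Q hQ e
    have h2 := H Q' hQ' rfl
    have h3 : f a ∈ Q := by
      have := Q.sub_mem (Q.mul_mem_left (f s) hb) h1
      simpa using this
    have h4 : f a ∈ Q' := by
      have : a ∈ Q.comap f := h3
      rw [e] at this
      exact this
    have h5 : f s * b ∈ Q' := by simpa using Q'.add_mem h2 h4
    exact (hQ'.mem_or_mem h5).resolve_left hs
  exact le_antisymm (key Q Q' hQ hQ' e) (key Q' Q hQ' hQ e.symm)

theorem ElemSub.residue {A : Type u} {B : Type v} [CommRing A] [CommRing B] {f : A →+* B}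
    (h : ElemSub f) : InducesResidueFieldIsos f := by
  intro q hq
  refine ⟨RingHom.injective _, ?_⟩
  change Function.Surjective (Ideal.ResidueField.map (q.comap f) q f rfl)
  have key : ∀ b : B, ∃ x, Ideal.ResidueField.map (q.comap f) q f rfl x =
      algebraMap B q.ResidueField b := by
    intro b
    obtain ⟨a, s, hs, H⟩ := h (q.comap f) (hq.comap f) b
    have h1 := H q hq rfl
    rw [← Ideal.algebraMap_residueField_eq_zero, map_sub, map_mul, sub_eq_zero] at h1
    have hs' : algebraMap B q.ResidueField (f s) ≠ 0 := by
      rw [Ne, Ideal.algebraMap_residueField_eq_zero]; exact hs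
    refine ⟨algebraMap A _ a / algebraMap A _ s, ?_⟩
    rw [map_div₀, Ideal.ResidueField.map_algebraMap, Ideal.ResidueField.map_algebraMap,
      div_eq_iff hs', ← h1, mul_comm]
  intro y
  obtain ⟨u, v, hv, rfl⟩ := IsFractionRing.div_surjective (A := B ⧸ q) y
  obtain ⟨u, rfl⟩ := Ideal.Quotient.mk_surjective u
  obtain ⟨v, rfl⟩ := Ideal.Quotient.mk_surjective v
  obtain ⟨x, hx⟩ := key u
  obtain ⟨z, hz⟩ := key v
  exact ⟨x / z, by rw [map_div₀, hx, hz]; rfl⟩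

theorem ElemSub.of_residue {A : Type u} {B : Type v} [CommRing A] [CommRing B] {f : A →+* B}
    (hinj : Function.Injective (PrimeSpectrum.comap f)) (h : InducesResidueFieldIsos f) :
    ElemSub f := by
  intro p hp b
  by_cases hex : ∃ q : Ideal B, q.IsPrime ∧ q.comap f = p
  · obtain ⟨q, hq, rfl⟩ := hex
    obtain ⟨x, hx⟩ := (h q).2 (algebraMap B q.ResidueField b)
    change Ideal.ResidueField.map (q.comap f) q f rfl x = _ at hx
    obtain ⟨u, v, hv, rfl⟩ := IsFractionRing.div_surjective (A := A ⧸ q.comap f) x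
    obtain ⟨u, rfl⟩ := Ideal.Quotient.mk_surjective u
    obtain ⟨v, rfl⟩ := Ideal.Quotient.mk_surjective v
    have hv' : v ∉ q.comap f := by
      intro hmem
      exact nonZeroDivisors.ne_zero hv (Ideal.Quotient.eq_zero_iff_mem.mpr hmem)
    refine ⟨u, v, hv', ?_⟩
    intro Q hQ e
    have : Q = q := by
      have := @hinj ⟨Q, hQ⟩ ⟨q, hq⟩ (PrimeSpectrum.ext e)
      exact congrArg PrimeSpectrum.asIdeal this
    subst this
    rw [Ideal.algebraMap_quotient_residueField_mk, Ideal.algebraMap_quotient_residueField_mk,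
      map_div₀, Ideal.ResidueField.map_algebraMap, Ideal.ResidueField.map_algebraMap,
      div_eq_iff] at hx
    · rw [← Ideal.algebraMap_residueField_eq_zero, map_sub, map_mul, hx, mul_comm, sub_self]
    · rw [Ne, Ideal.algebraMap_residueField_eq_zero]; exact hv'
  · exact ⟨0, 1, fun h1 => hp.ne_top ((Ideal.eq_top_iff_one _).mpr h1),
      fun Q hQ e => absurd ⟨Q, hQ, e⟩ hex⟩

theorem ElemSub.comp' {A : Type*} {B : Type*} {E : Type*} [CommRing A] [CommRing B] [CommRing E]
    {f : A →+* B} {g : B →+* E} (hf : ElemSub f) (hg : ElemSub g) : ElemSub (g.comp f) := by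
  intro p hp b
  by_cases hex : ∃ q : Ideal B, q.IsPrime ∧ q.comap f = p
  · obtain ⟨q, hq, rfl⟩ := hex
    obtain ⟨a', s', hs', H⟩ := hg q hq b
    obtain ⟨a1, s1, hs1, H1⟩ := hf (q.comap f) (hq.comap f) a'
    obtain ⟨a2, s2, hs2, H2⟩ := hf (q.comap f) (hq.comap f) s'
    have h1 := H1 q hq rfl
    have h2 := H2 q hq rfl
    have ha2 : a2 ∉ q.comap f := by
      intro hmem
      have : f s2 * s' ∈ q := by simpa using q.add_mem h2 hmem
      exact (hq.mem_or_mem this).elim hs2 hs'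
    refine ⟨s2 * a1, s1 * a2, fun hm => ((hq.comap f).mem_or_mem hm).elim hs1 ha2, ?_⟩
    intro Q hQ e
    have e' : Q.comap g = q := hf.comap_inj _ _ (hQ.comap g) hq (by rw [Ideal.comap_comap, e])
    have k := H Q hQ e'
    rw [← e'] at h1 h2
    rw [Ideal.mem_comap] at h1 h2
    have := Q.sub_mem (Q.add_mem (Q.mul_mem_left (g (f s1) * g (f s2)) k)
      (Q.mul_mem_left (g (f s2)) h1)) (Q.mul_mem_left (g (f s1) * b) h2)
    convert this using 1
    simp only [RingHom.comp_apply, map_mul, map_sub]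
    ring
  · exact ⟨0, 1, fun h1 => hp.ne_top ((Ideal.eq_top_iff_one _).mpr h1),
      fun Q hQ e => absurd ⟨Q.comap g, hQ.comap g, by rw [Ideal.comap_comap, e]⟩ hex⟩

theorem ElemSub.bij {A : Type u} {B : Type v} [CommRing A] [CommRing B] {f : A →+* B}
    (h : ElemSub f) (hi : f.IsIntegral) (hinj : Function.Injective f) :
    Function.Bijective (PrimeSpectrum.comap f) :=
  ⟨fun Q Q' e => PrimeSpectrum.ext (h.comap_inj _ _ Q.2 Q'.2 (congrArg PrimeSpectrum.asIdeal e)),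
    hi.comap_surjective hinj⟩

/-- Largest subintegral subextension of an algebra. -/
def subHull (A : Type*) (N : Type*) [CommRing A] [CommRing N] [Algebra A N] : Subalgebra A N where
  carrier := {x | ∀ (p : Ideal A), p.IsPrime → ∃ a s : A, s ∉ p ∧
    ∀ Q : Ideal N, Q.IsPrime → Q.comap (algebraMap A N) = p →
      algebraMap A N s * x - algebraMap A N a ∈ Q}
  mul_mem' := by
    intro x y hx hy p hp
    obtain ⟨a, s, hs, H⟩ := hx p hp
    obtain ⟨a', s', hs', H'⟩ := hy p hp
    refine ⟨a * a', s * s', fun hm => (hp.mem_or_mem hm).elim hs hs', fun Q hQ e => ?_⟩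
    have := Q.add_mem (Q.mul_mem_left (algebraMap A N s' * y) (H Q hQ e))
      (Q.mul_mem_left (algebraMap A N a) (H' Q hQ e))
    convert this using 1
    simp only [map_mul]
    ring
  add_mem' := by
    intro x y hx hy p hp
    obtain ⟨a, s, hs, H⟩ := hx p hp
    obtain ⟨a', s', hs', H'⟩ := hy p hp
    refine ⟨s' * a + s * a', s * s', fun hm => (hp.mem_or_mem hm).elim hs hs', fun Q hQ e => ?_⟩
    have := Q.add_mem (Q.mul_mem_left (algebraMap A N s') (H Q hQ e))
      (Q.mul_mem_left (algebraMap A N s) (H' Q hQ e))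
    convert this using 1
    simp only [map_mul, map_add]
    ring
  algebraMap_mem' := by
    intro r p hp
    exact ⟨r, 1, fun h1 => hp.ne_top ((Ideal.eq_top_iff_one _).mpr h1), fun Q hQ e => by simp⟩

/-- The subintegral hull inside the normalization. -/
noncomputable def hullFrac (A : Type u) [CommRing A] : Subalgebra A (FractionRing A) :=
  (subHull A ↥(integralClosure A (FractionRing A))).map (integralClosure A (FractionRing A)).val

theorem hullFrac_le (A : Type u) [CommRing A] :
    hullFrac A ≤ integralClosure A (FractionRing A) := by
  rintro _ ⟨x, -, rfl⟩
  exact x.2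

theorem isIntegral_algebraMap_of_le {A : Type u} [CommRing A] (T : Subalgebra A (FractionRing A))
    (hT : T ≤ integralClosure A (FractionRing A)) : (algebraMap A T).IsIntegral := by
  intro x
  have h : IsIntegral A (T.val x) := hT x.2
  exact (isIntegral_algHom_iff T.val Subtype.val_injective).mp h

theorem elemSub_of_le {A : Type u} [CommRing A] (T : Subalgebra A (FractionRing A))
    (hT : T ≤ hullFrac A) : ElemSub (algebraMap A T) := by
  intro p hp b
  obtain ⟨x, hx, hxb⟩ := hT b.2
  obtain ⟨a, s, hs, H⟩ := hx p hp
  refine ⟨a, s, hs, fun Q hQ e => ?_⟩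
  let i : T →+* ↥(integralClosure A (FractionRing A)) :=
    (Subalgebra.inclusion (hT.trans (hullFrac_le A))).toRingHom
  have hii : Function.Injective i := Subalgebra.inclusion_injective _
  have hcomp : i.comp (algebraMap A T) = algebraMap A _ := rfl
  have hint : i.IsIntegral := by
    apply RingHom.IsIntegral.tower_top (algebraMap A T)
    rw [hcomp]
    exact isIntegral_algebraMap_of_le _ le_rfl
  obtain ⟨⟨q, hq⟩, hqQ⟩ := hint.comap_surjective hii ⟨Q, hQ⟩
  have hqQ' : q.comap i = Q := congrArg PrimeSpectrum.asIdeal hqQ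
  have k := H q hq (by rw [← hcomp, ← Ideal.comap_comap, hqQ', e])
  rw [← hqQ', Ideal.mem_comap]
  convert k using 1
  have : i b = x := Subtype.ext hxb.symm
  rw [map_sub, map_mul, this]
  rfl

theorem isUnit_of_nzd {A : Type u} [CommRing A] (T : Subalgebra A (FractionRing A))
    (y : nonZeroDivisors T) : IsUnit (T.val.toRingHom y) := by
  obtain ⟨⟨y, hyT⟩, hy⟩ := y
  obtain ⟨⟨u, v⟩, huv⟩ := IsLocalization.surj (nonZeroDivisors A) y
  have huv' : y * algebraMap A (FractionRing A) v = algebraMap A (FractionRing A) u := huv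
  have hu : u ∈ nonZeroDivisors A := by
    rw [mem_nonZeroDivisors_iff_right]
    intro a ha
    have h1 : (algebraMap A T (a * v)) * (⟨y, hyT⟩ : T) = 0 := by
      apply Subtype.ext
      change algebraMap A (FractionRing A) (a * v) * y = 0
      rw [map_mul, mul_assoc, mul_comm _ y, huv', ← map_mul, ha, map_zero]
    have h2 := (mem_nonZeroDivisors_iff_right.mp hy) _ h1
    have h3 : algebraMap A (FractionRing A) (a * v) = 0 := congrArg Subtype.val h2
    have h4 : a * v = 0 := IsFractionRing.injective A (FractionRing A) (by rw [h3, map_zero])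
    exact (mem_nonZeroDivisors_iff_right.mp v.2) _ h4
  have hunit : IsUnit (algebraMap A (FractionRing A) u) :=
    IsLocalization.map_units (FractionRing A) (⟨u, hu⟩ : nonZeroDivisors A)
  rw [← huv'] at hunit
  exact isUnit_of_mul_isUnit_left hunit

theorem hullFrac_seminormal (A : Type u) [CommRing A] : IsSeminormalRing (hullFrac A) := by
  intro B _ f hinj hfin hbir hspec hres
  obtain ⟨hle, hbij⟩ := hbir
  let P := hullFrac A
  let φ := RingEquiv.ofBijective _ hbij
  let ψ : FractionRing P →+* FractionRing A :=
    IsLocalization.lift (M := nonZeroDivisors P) (g := P.val.toRingHom) (isUnit_of_nzd P)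
  have hψ : Function.Injective ψ := by
    rw [IsLocalization.lift_injective_iff]
    intro x y
    rw [(IsFractionRing.injective P (FractionRing P)).eq_iff]
    exact (Subtype.val_injective.eq_iff).symm
  let h : B →+* FractionRing A :=
    ψ.comp (φ.symm.toRingHom.comp (algebraMap B (FractionRing B)))
  have hh : Function.Injective h :=
    hψ.comp (φ.symm.injective.comp (IsFractionRing.injective B (FractionRing B)))
  have hhf : ∀ z : P, h (f z) = z := by
    intro z
    have : φ.symm (algebraMap B (FractionRing B) (f z)) = algebraMap P (FractionRing P) z := by
      rw [RingEquiv.symm_apply_eq]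
      exact (IsLocalization.map_eq hle z).symm
    change ψ (φ.symm (algebraMap B (FractionRing B) (f z))) = _
    rw [this]
    exact IsLocalization.lift_eq _ _
  refine ⟨hinj, fun b => ?_⟩
  have hES : ElemSub (f.comp (algebraMap A P)) :=
    (elemSub_of_le P le_rfl).comp' (ElemSub.of_residue hspec.1 hres)
  have hint : (f.comp (algebraMap A P)).IsIntegral :=
    RingHom.IsIntegral.trans _ _ (isIntegral_algebraMap_of_le P (hullFrac_le A)) hfin.to_isIntegral
  have hcomp : h.comp (f.comp (algebraMap A P)) = algebraMap A (FractionRing A) := by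
    ext a
    exact hhf _
  have hmem : ∀ b, h b ∈ integralClosure A (FractionRing A) := by
    intro b
    obtain ⟨m, hm, hm0⟩ := hint b
    refine ⟨m, hm, ?_⟩
    rw [← hcomp, ← Polynomial.hom_eval₂, hm0, map_zero]
  let h' : B →+* ↥(integralClosure A (FractionRing A)) := h.codRestrict _ hmem
  have hcomp' : h'.comp (f.comp (algebraMap A P)) = algebraMap A _ := by
    ext a
    exact hhf _
  have hb : h b ∈ P := by
    refine ⟨h' b, ?_, rfl⟩
    intro p hp
    obtain ⟨a, s, hs, H⟩ := hES p hp b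
    refine ⟨a, s, hs, fun Q hQ e => ?_⟩
    have := H (Q.comap h') (hQ.comap h') (by rw [Ideal.comap_comap, hcomp', e])
    rw [Ideal.mem_comap, map_sub, map_mul, ← RingHom.comp_apply h', ← RingHom.comp_apply h',
      hcomp'] at this
    exact this
  exact ⟨⟨h b, hb⟩, hh (hhf _)⟩

/-- With `D = (R/√(cR))^SN ∩ (R^N/√(c R^N))` and `C` the pullback of
`R^N → R^N/√(c R^N) ← D`, the induced ring homomorphism `R^SN → C` (the one compatible
with the inclusions into `R^N`) is a bijection on prime spectra and induces isomorphisms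
of all residue fields. -/
theorem statement3 (R : Type) [CommRing R] [IsReduced R] [IsNoetherianRing R]
    [Module.Finite R ↥(integralClosure R (FractionRing R))]
    (SR : Subalgebra R (FractionRing R)) (hSR : IsSeminormalization R SR)
    (SA : Subalgebra (AQuot R) (FractionRing (AQuot R)))
    (hSA : IsSeminormalization (AQuot R) SA)
    (j : ↥SA →+* FractionRing (NQuot R)) (hjinj : Function.Injective j)
    (hjcomp : ∀ a : AQuot R,
      j (algebraMap (AQuot R) ↥SA a) =
        algebraMap (NQuot R) (FractionRing (NQuot R)) (condQuotMap R a)) :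
    ∀ D : Subring (NQuot R),
      D = Subring.comap (algebraMap (NQuot R) (FractionRing (NQuot R)))
        (RingHom.range (R := ↥SA) (S := FractionRing (NQuot R)) j) →
    ∀ C : Subring (↥(integralClosure R (FractionRing R)) × ↥D),
      C = ringPullback (nQuotMk R) D.subtype →
    ∀ g : ↥SR →+* ↥C,
      (∀ s : ↥SR, ((g s).1.1 : FractionRing R) = (s : FractionRing R)) →
      Function.Bijective (PrimeSpectrum.comap g) ∧ InducesResidueFieldIsos g := by
  intro D hD C hC g hg
  have hSAle : SA ≤ hullFrac (AQuot R) :=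
    hSA.2.2 _ (hullFrac_le _) (hullFrac_seminormal _)
  have hSAsub : ElemSub (algebraMap (AQuot R) SA) := elemSub_of_le SA hSAle
  have hSAint : (algebraMap (AQuot R) SA).IsIntegral := isIntegral_algebraMap_of_le SA hSA.1
  have hCmem : ∀ z : ↥(integralClosure R (FractionRing R)) × ↥D, z ∈ C ↔ nQuotMk R z.1 = z.2 := by
    intro z; rw [hC]; rfl
  have hDmem : ∀ z : NQuot R, z ∈ D ↔ ∃ x, j x = algebraMap _ (FractionRing (NQuot R)) z := by
    intro z; rw [hD]; rfl
  -- injectivity of the first projection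
  have hC1 : ∀ z w : C, z.1.1 = w.1.1 → z = w := by
    intro z w h
    refine Subtype.ext (Prod.ext h (Subtype.ext ?_))
    rw [← (hCmem _).mp z.2, ← (hCmem _).mp w.2, h]
  let F : R →+* C := g.comp (algebraMap R SR)
  have hF1 : ∀ r, (F r).1.1 = algebraMap R ↥(integralClosure R (FractionRing R)) r := by
    intro r
    apply Subtype.ext
    exact hg _
  have hF2 : ∀ r, ((F r).1.2 : NQuot R) = condQuotMap R (aQuotMk R r) := by
    intro r
    rw [← (hCmem _).mp (F r).2, hF1]
    rfl
  -- the map from `D` to `SA`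
  have hex : ∀ d : D, ∃ x : SA, j x = algebraMap _ (FractionRing (NQuot R)) d.1 :=
    fun d => (hDmem _).mp d.2
  choose e he using hex
  have hfr := IsFractionRing.injective (NQuot R) (FractionRing (NQuot R))
  let E : D →+* SA :=
    { toFun := e
      map_one' := hjinj (by rw [he]; simp)
      map_zero' := hjinj (by rw [he]; simp)
      map_mul' := fun x y => hjinj (by rw [map_mul, he, he, he]; simp)
      map_add' := fun x y => hjinj (by rw [map_add, he, he, he]; simp) }
  have hE : ∀ d, j (E d) = algebraMap _ (FractionRing (NQuot R)) d.1 := he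
  have hEinj : Function.Injective E := by
    intro x y h
    apply Subtype.ext
    apply hfr
    rw [← hE, ← hE, h]
  let G : AQuot R →+* D := (condQuotMap R).codRestrict D
    (fun a => (hDmem _).mpr ⟨_, hjcomp a⟩)
  have hEG : E.comp G = algebraMap (AQuot R) SA := by
    ext1 a
    apply hjinj
    rw [hjcomp, RingHom.comp_apply, hE]
    rfl
  have hEint : E.IsIntegral := by
    apply RingHom.IsIntegral.tower_top G
    rw [hEG]; exact hSAint
  -- the projection `C → D`
  let π : C →+* D := (RingHom.snd ↥(integralClosure R (FractionRing R)) D).comp C.subtype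
  have hπsurj : Function.Surjective π := by
    intro d
    obtain ⟨y, hy⟩ := Ideal.Quotient.mk_surjective d.1
    exact ⟨⟨(y, d), (hCmem _).mpr hy⟩, rfl⟩
  have hπF : ∀ r, π (F r) = G (aQuotMk R r) := by
    intro r
    apply Subtype.ext
    exact hF2 r
  -- the conductor
  have hcond : ∀ t ∈ conductorIdeal R, ∀ y : ↥(integralClosure R (FractionRing R)), ∃ r : R, algebraMap R ↥(integralClosure R (FractionRing R)) r = algebraMap R ↥(integralClosure R (FractionRing R)) t * y := by
    intro t ht y
    have h1 := (Module.mem_annihilator.mp ht) (Submodule.Quotient.mk y)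
    rw [← Submodule.Quotient.mk_smul, Submodule.Quotient.mk_eq_zero] at h1
    obtain ⟨r, hr⟩ := h1
    exact ⟨r, by rw [← Algebra.smul_def]; exact hr⟩
  have hcond' : ∀ t ∈ conductorIdeal R, ∀ y : ↥(integralClosure R (FractionRing R)), ∃ r ∈ conductorIdeal R,
      algebraMap R ↥(integralClosure R (FractionRing R)) r = algebraMap R ↥(integralClosure R (FractionRing R)) t * y := by
    intro t ht y
    obtain ⟨r, hr⟩ := hcond t ht y
    refine ⟨r, ?_, hr⟩
    refine Module.mem_annihilator.mpr fun m => ?_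
    obtain ⟨z, rfl⟩ := Submodule.Quotient.mk_surjective _ m
    rw [← Submodule.Quotient.mk_smul, Submodule.Quotient.mk_eq_zero]
    obtain ⟨r', hr'⟩ := hcond t ht (y * z)
    refine ⟨r', ?_⟩
    rw [Algebra.smul_def, hr, mul_assoc]
    exact hr'
  have hmap : ∀ y ∈ (conductorIdeal R).map (algebraMap R ↥(integralClosure R (FractionRing R))), ∃ r ∈ conductorIdeal R,
      algebraMap R ↥(integralClosure R (FractionRing R)) r = y := by
    intro y hy
    induction hy using Submodule.span_induction with
    | mem x hx => exact hx
    | zero => exact ⟨0, Ideal.zero_mem _, map_zero _⟩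
    | add x y _ _ hx hy =>
      obtain ⟨r, hr, rfl⟩ := hx
      obtain ⟨r', hr', rfl⟩ := hy
      exact ⟨r + r', Ideal.add_mem _ hr hr', map_add _ _ _⟩
    | smul a x _ hx =>
      obtain ⟨r, hr, rfl⟩ := hx
      obtain ⟨r', hr', h⟩ := hcond' r hr a
      exact ⟨r', hr', by rw [h, smul_eq_mul, mul_comm]⟩
  have hker : ∀ Q : Ideal C, Q.IsPrime → conductorIdeal R ≤ Q.comap F →
      RingHom.ker π ≤ Q := by
    intro Q hQ hle z hz
    have hz2 : (z.1.2 : NQuot R) = 0 := congrArg Subtype.val hz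
    have hz1 := (hCmem _).mp z.2
    rw [hz2] at hz1
    have hz3 : z.1.1 ∈ ((conductorIdeal R).map (algebraMap R ↥(integralClosure R (FractionRing R)))).radical :=
      Ideal.Quotient.eq_zero_iff_mem.mp hz1
    obtain ⟨n, hn⟩ := hz3
    obtain ⟨r, hr, hrz⟩ := hmap _ hn
    have : F r = z ^ n := by
      apply hC1
      rw [hF1, hrz]
      rfl
    have h2 : F r ∈ Q := hle hr
    rw [this] at h2
    exact hQ.mem_of_pow_mem n h2
  have hFsub : ElemSub F := by
    intro p hp b
    by_cases hpc : conductorIdeal R ≤ p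
    · have hrad : (conductorIdeal R).radical ≤ p := hp.radical_le_iff.mpr hpc
      have hqs : Function.Surjective (aQuotMk R) := Ideal.Quotient.mk_surjective
      have hkA : RingHom.ker (aQuotMk R) ≤ p := by
        intro x hx
        exact hrad (Ideal.Quotient.eq_zero_iff_mem.mp hx)
      have hpb : (p.map (aQuotMk R)).IsPrime := Ideal.map_isPrime_of_surjective hqs hkA
      have hpb' : (p.map (aQuotMk R)).comap (aQuotMk R) = p := by
        rw [Ideal.comap_map_of_surjective _ hqs]
        exact sup_eq_left.mpr hkA
      obtain ⟨a, s, hs, H⟩ := hSAsub _ hpb (E (π b))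
      obtain ⟨a, rfl⟩ := hqs a
      obtain ⟨s, rfl⟩ := hqs s
      refine ⟨a, s, fun hm => hs (Ideal.mem_map_of_mem _ hm), fun Q hQ hQp => ?_⟩
      have hk := hker Q hQ (by rw [hQp]; exact hpc)
      have hQb : (Q.map π).IsPrime := Ideal.map_isPrime_of_surjective hπsurj hk
      have hQb' : (Q.map π).comap π = Q := by
        rw [Ideal.comap_map_of_surjective _ hπsurj]
        exact sup_eq_left.mpr hk
      obtain ⟨⟨q, hq⟩, hqQ⟩ := hEint.comap_surjective hEinj ⟨Q.map π, hQb⟩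
      have hqQ' : q.comap E = Q.map π := congrArg PrimeSpectrum.asIdeal hqQ
      have k := H q hq (by
        apply Ideal.comap_injective_of_surjective _ hqs
        rw [hpb', ← hEG, ← Ideal.comap_comap, hqQ', ← hQp]
        ext r
        rw [Ideal.mem_comap, Ideal.mem_comap, Ideal.mem_comap, ← hπF, ← Ideal.mem_comap, hQb'])
      have hAE : ∀ r, algebraMap (AQuot R) SA (aQuotMk R r) = E (π (F r)) := by
        intro r
        rw [hπF, ← hEG]
        rfl
      rw [hAE, hAE] at k
      have k1 : F s * b - F a ∈ (q.comap E).comap π := by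
        rw [Ideal.mem_comap, Ideal.mem_comap, map_sub, map_mul, map_sub, map_mul]
        exact k
      rw [hqQ', hQb'] at k1
      exact k1
    · obtain ⟨t, ht, htp⟩ := SetLike.not_le_iff_exists.mp hpc
      obtain ⟨r, hr⟩ := hcond t ht b.1.1
      refine ⟨r, t, htp, fun Q _ _ => ?_⟩
      have : F t * b = F r := by
        apply hC1
        rw [hF1, hr, ← hF1]
        rfl
      rw [this, sub_self]
      exact Q.zero_mem
  have hgsub : ElemSub g := by
    intro p hp b
    obtain ⟨a, s, hs, H⟩ := hFsub (p.comap (algebraMap R SR)) (hp.comap _) b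
    refine ⟨algebraMap R SR a, algebraMap R SR s, hs, fun Q hQ hQp => H Q hQ ?_⟩
    rw [← hQp, Ideal.comap_comap]
  have hginj : Function.Injective g := by
    intro x y h
    apply Subtype.ext
    rw [← hg, ← hg, h]
  have hFint : F.IsIntegral := by
    intro z
    obtain ⟨m, hm, hm0⟩ := isIntegral_algebraMap_of_le (integralClosure R (FractionRing R)) le_rfl z.1.1
    refine ⟨m, hm, ?_⟩
    apply hC1
    let ρ : C →+* ↥(integralClosure R (FractionRing R)) := (RingHom.fst ↥(integralClosure R (FractionRing R)) D).comp C.subtype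
    have hρ : ρ.comp F = algebraMap R ↥(integralClosure R (FractionRing R)) := by
      ext1 r
      exact hF1 r
    change ρ (Polynomial.eval₂ F z m) = ρ 0
    rw [Polynomial.hom_eval₂, hρ, map_zero]
    exact hm0
  have hgint : g.IsIntegral := RingHom.IsIntegral.tower_top (algebraMap R SR) g hFint
  exact ⟨hgsub.bij hgint hginj, hgsub.residue⟩
end

section
/- Let R = ℚ[x,y]/(x·y·(x² − y²)), the coordinate ring of four distinct lines through the origin in the affine plane over ℚ. Then the seminormalization of R is isomorphic to ℚ[Y₀, Y₁, Y₂, Y₃]/(Y_i Y_j : 0 ≤ i < j ≤ 3), the coordinate ring of the four coordinate axes in affine 4-space. -/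
universe u v

set_option synthInstance.maxHeartbeats 1000000
set_option maxHeartbeats 1000000

open MvPolynomial in
/-- Four distinct lines through the origin in the affine plane: `ℚ[x,y]/(xy(x²-y²))`. -/
noncomputable abbrev FourLines : Type :=
  MvPolynomial (Fin 2) ℚ ⧸
    Ideal.span {(X 0 : MvPolynomial (Fin 2) ℚ) * X 1 * (X 0 ^ 2 - X 1 ^ 2)}

open MvPolynomial in
/-- The four coordinate axes in affine 4-space: `ℚ[Y₀,Y₁,Y₂,Y₃]/(YᵢYⱼ : i < j)`. -/
noncomputable abbrev FourAxes : Type :=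
  MvPolynomial (Fin 4) ℚ ⧸
    Ideal.span {p : MvPolynomial (Fin 4) ℚ | ∃ i j : Fin 4, i < j ∧ p = X i * X j}

theorem birational_of_conductor {S A : Type*} [CommRing S] [CommRing A] (f : S →+* A)
    (hf : Function.Injective f) (d : S) (hd : f d ∈ nonZeroDivisors A)
    (hdA : ∀ a, ∃ s, f s = f d * a) : IsBirationalHom f := by
  have hback : ∀ s, f s ∈ nonZeroDivisors A → s ∈ nonZeroDivisors S := by
    intro s hs
    rw [mem_nonZeroDivisors_iff_right] at hs ⊢
    intro z hz
    apply hf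
    rw [map_zero]
    apply hs
    rw [← map_mul, hz, map_zero]
  have hle : nonZeroDivisors S ≤ Submonoid.comap f (nonZeroDivisors A) := by
    intro s hs
    rw [Submonoid.mem_comap, mem_nonZeroDivisors_iff_right]
    rw [mem_nonZeroDivisors_iff_right] at hs hd
    intro a ha
    obtain ⟨s', hs'⟩ := hdA a
    have : s' = 0 := by
      apply hs
      apply hf
      rw [map_mul, hs', mul_assoc, ha, mul_zero, map_zero]
    apply hd
    rw [mul_comm, ← hs', this, map_zero]
  refine ⟨hle, ?_, ?_⟩
  · rw [injective_iff_map_eq_zero]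
    intro x hx
    obtain ⟨a, s, rfl⟩ := IsLocalization.exists_mk'_eq (nonZeroDivisors S) x
    rw [IsLocalization.map_mk', IsLocalization.mk'_eq_zero_iff] at hx
    obtain ⟨m, hm⟩ := hx
    have h0 : f a = 0 := by
      have := m.2
      rw [mem_nonZeroDivisors_iff_right] at this
      apply this
      rw [mul_comm]; exact hm
    have : a = 0 := hf (by rw [h0, map_zero])
    rw [this, IsLocalization.mk'_zero]
  · intro x
    obtain ⟨a, b, rfl⟩ := IsLocalization.exists_mk'_eq (nonZeroDivisors A) x
    obtain ⟨s, hs⟩ := hdA a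
    obtain ⟨s', hs'⟩ := hdA b
    have hs'n : s' ∈ nonZeroDivisors S := hback _ (by rw [hs']; exact mul_mem hd b.2)
    refine ⟨IsLocalization.mk' _ s (⟨s', hs'n⟩ : nonZeroDivisors S), ?_⟩
    rw [IsLocalization.map_mk']
    apply IsLocalization.mk'_eq_of_eq
    simp only [hs, hs']
    ring

theorem spec_of_conductor {ι S A : Type*} [CommRing S] [CommRing A] (f : S →+* A)
    (hf : Function.Injective f) (hfin : f.Finite) (t : ι → A)
    (ht : ∀ i a, ∃ s, f s = t i ^ 3 * a)
    (hm : ∀ a, ∃ s, a - f s ∈ Ideal.span (Set.range t)) :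
    Function.Bijective (PrimeSpectrum.comap f) ∧ InducesResidueFieldIsos f := by
  have key : ∀ q q' : Ideal A, q.IsPrime → q'.IsPrime → q.comap f = q'.comap f → q ≤ q' := by
    intro q q' hq hq' h a ha
    have hmem : ∀ s, f s ∈ q ↔ f s ∈ q' := fun s => by
      rw [← Ideal.mem_comap, h, Ideal.mem_comap]
    by_cases hall : ∀ i, t i ∈ q
    · have hall' : ∀ i, t i ∈ q' := by
        intro i
        obtain ⟨s, hs⟩ := ht i 1
        rw [mul_one] at hs
        apply hq'.mem_of_pow_mem 3
        rw [← hs, ← hmem, hs]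
        exact Ideal.pow_mem_of_mem _ (hall i) 3 (by norm_num)
      obtain ⟨s, hs⟩ := hm a
      have h1 : a - f s ∈ q := Ideal.span_le.2 (by rintro _ ⟨i, rfl⟩; exact hall i) hs
      have h2 : a - f s ∈ q' := Ideal.span_le.2 (by rintro _ ⟨i, rfl⟩; exact hall' i) hs
      have h3 : f s ∈ q := (Submodule.sub_mem_iff_right q ha).1 h1
      exact (Submodule.sub_mem_iff_left q' ((hmem s).1 h3)).1 h2
    · push Not at hall
      obtain ⟨i, hi⟩ := hall
      obtain ⟨s, hs⟩ := ht i a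
      obtain ⟨s', hs'⟩ := ht i 1
      rw [mul_one] at hs'
      have h1 : f s ∈ q' := (hmem s).1 (by rw [hs]; exact Ideal.mul_mem_left _ _ ha)
      rw [hs] at h1
      refine (hq'.mem_or_mem h1).resolve_left ?_
      rw [← hs', ← hmem, hs']
      exact fun h => hi (hq.mem_of_pow_mem 3 h)
  refine ⟨⟨?_, ?_⟩, ?_⟩
  · intro q q' h
    have h' : q.asIdeal.comap f = q'.asIdeal.comap f := congrArg PrimeSpectrum.asIdeal h
    ext1
    exact le_antisymm (key _ _ q.2 q'.2 h') (key _ _ q'.2 q.2 h'.symm)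
  · exact RingHom.IsIntegral.comap_surjective hfin.to_isIntegral hf
  · intro q hq
    refine ⟨RingHom.injective _, ?_⟩
    set ψ := IsLocalRing.ResidueField.map (Localization.localRingHom (q.comap f) q f rfl) with hψ
    have hψs : ∀ s, ψ (algebraMap S (q.comap f).ResidueField s) = algebraMap A q.ResidueField (f s) := by
      intro s
      exact Ideal.ResidueField.map_algebraMap _ _ f rfl s
    have hz : ∀ a, algebraMap A q.ResidueField a = 0 ↔ a ∈ q := fun a =>
      Ideal.algebraMap_residueField_eq_zero
    have hr : ∀ a, algebraMap A q.ResidueField a ∈ ψ.fieldRange := by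
      intro a
      by_cases hall : ∀ i, t i ∈ q
      · obtain ⟨s, hs⟩ := hm a
        have h1 : a - f s ∈ q := Ideal.span_le.2 (by rintro _ ⟨i, rfl⟩; exact hall i) hs
        refine ⟨algebraMap _ _ s, ?_⟩
        rw [hψs]
        rw [← hz, map_sub, sub_eq_zero] at h1
        exact h1.symm
      · push Not at hall
        obtain ⟨i, hi⟩ := hall
        obtain ⟨s, hs⟩ := ht i a
        obtain ⟨s', hs'⟩ := ht i 1
        rw [mul_one] at hs'
        have hne : algebraMap A q.ResidueField (f s') ≠ 0 := by
          rw [Ne, hz, hs']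
          exact fun h => hi (hq.mem_of_pow_mem 3 h)
        have : algebraMap A q.ResidueField a
            = algebraMap A q.ResidueField (f s) / algebraMap A q.ResidueField (f s') := by
          rw [eq_div_iff hne, ← map_mul, hs, hs', mul_comm]
        rw [this, ← hψs, ← hψs]
        exact div_mem ⟨_, rfl⟩ ⟨_, rfl⟩
    intro x
    obtain ⟨y, rfl⟩ := IsLocalRing.residue_surjective x
    obtain ⟨a, b, rfl⟩ := IsLocalization.exists_mk'_eq q.primeCompl y
    have hb : algebraMap A q.ResidueField b ≠ 0 := by
      rw [Ne, hz]; exact b.2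
    have : IsLocalRing.residue (Localization.AtPrime q) (IsLocalization.mk' _ a b)
        = algebraMap A q.ResidueField a / algebraMap A q.ResidueField b := by
      rw [eq_div_iff hb]
      change _ * IsLocalRing.residue _ (algebraMap A (Localization.AtPrime q) b) = IsLocalRing.residue _ (algebraMap A (Localization.AtPrime q) a)
      rw [← map_mul, IsLocalization.mk'_spec]
    rw [this]
    exact div_mem (hr a) (hr b)

open Polynomial in
theorem extend_to_overring {A B : Type*} [CommRing A] [CommRing B] (g : A →+* B)
    (hfin : g.Finite) (hbir : IsBirationalHom g) (e : A →+* ℚ[X])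
    (he : ∀ s ∈ nonZeroDivisors A, e s ≠ 0) :
    ∃ p : B →+* ℚ[X], p.comp g = e := by
  obtain ⟨hle, hbij⟩ := hbir
  let K := FractionRing ℚ[X]
  let e' : A →+* K := (algebraMap ℚ[X] K).comp e
  have hu : ∀ s : nonZeroDivisors A, IsUnit (e' s) := by
    intro s
    rw [isUnit_iff_ne_zero]
    intro h
    apply he s s.2
    apply IsFractionRing.injective ℚ[X] K
    rw [map_zero]; exact h
  let L : FractionRing A →+* K := IsLocalization.lift hu
  let E := RingEquiv.ofBijective _ hbij
  let P : B →+* K := (L.comp E.symm.toRingHom).comp (algebraMap B (FractionRing B))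
  have hP : ∀ a, P (g a) = algebraMap ℚ[X] K (e a) := by
    intro a
    have h1 : E.symm (algebraMap B (FractionRing B) (g a)) = algebraMap A (FractionRing A) a := by
      rw [RingEquiv.symm_apply_eq]
      exact (IsLocalization.map_eq (T := nonZeroDivisors B) hle a).symm
    change L (E.symm (algebraMap B (FractionRing B) (g a))) = _
    rw [h1]
    exact IsLocalization.lift_eq hu a
  have hr : ∀ b, ∃ y, algebraMap ℚ[X] K y = P b := by
    intro b
    obtain ⟨m, hm, hmb⟩ := hfin.to_isIntegral b
    apply IsIntegrallyClosed.isIntegral_iff.1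
    refine ⟨m.map e, hm.map e, ?_⟩
    rw [Polynomial.eval₂_map]
    have : (algebraMap ℚ[X] K).comp e = P.comp g := by ext a; exact (hP a).symm
    rw [this, ← Polynomial.hom_eval₂, hmb, map_zero]
  choose p hp using hr
  have hinj := IsFractionRing.injective ℚ[X] K
  refine ⟨⟨⟨⟨p, ?_⟩, ?_⟩, ?_, ?_⟩, ?_⟩
  · apply hinj; simp [hp]
  · intro x y; apply hinj; simp [hp]
  · apply hinj; simp [hp]
  · intro x y; apply hinj; simp [hp]
  · ext1 a; apply hinj
    exact (hp (g a)).trans (hP a)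

open Polynomial in
theorem seminormal_axes (A : Type) [CommRing A] (pr : A →+* (Fin 4 → ℚ[X]))
    (hinj : Function.Injective pr)
    (hr : ∀ x, x ∈ pr.range ↔ ∀ i j, (x i).eval 0 = (x j).eval 0) : IsSeminormalRing A := by
  intro B _ g hg hfin hbir hspec _
  refine ⟨hg, fun b => ?_⟩
  have htt : ∀ i : Fin 4, ∃ a, pr a = Pi.single i X := by
    intro i
    apply (hr _).2
    have : ∀ j, ((Pi.single i X : Fin 4 → ℚ[X]) j).eval 0 = 0 := by
      intro j
      by_cases h : j = i
      · subst h; simp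
      · simp [Pi.single_eq_of_ne h]
    intro j k; rw [this, this]
  have hnz : ∀ i, ∀ s ∈ nonZeroDivisors A, ((Pi.evalRingHom _ i).comp pr) s ≠ 0 := by
    intro i s hs h0
    obtain ⟨a, ha⟩ := htt i
    rw [mem_nonZeroDivisors_iff_right] at hs
    have : a = 0 := by
      apply hs
      apply hinj
      rw [map_mul, ha, map_zero]
      ext1 j
      by_cases h : j = i
      · subst h
        have h0' : pr s j = 0 := h0
        simp [h0']
      · simp [Pi.single_eq_of_ne h]
    rw [this, map_zero] at ha
    have := congrFun ha i
    simp at this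
    exact X_ne_zero this.symm
  choose p hp using fun i => extend_to_overring g hfin hbir _ (hnz i)
  have hp' : ∀ i a, p i (g a) = pr a i := fun i a => RingHom.congr_fun (hp i) a
  let e : Fin 4 → B →+* ℚ := fun i => (evalRingHom 0).comp (p i)
  have he : ∀ i b, e i b = (p i b).eval 0 := fun i b => rfl
  have hprs : ∀ a i j, (pr a i).eval 0 = (pr a j).eval 0 := fun a => (hr _).1 ⟨a, rfl⟩
  have hker : ∀ i j, RingHom.ker (e i) = RingHom.ker (e j) := by
    intro i j
    have : (⟨RingHom.ker (e i), RingHom.ker_isPrime _⟩ : PrimeSpectrum B)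
      = ⟨RingHom.ker (e j), RingHom.ker_isPrime _⟩ := by
      apply hspec.1
      ext a
      change e i (g a) = 0 ↔ e j (g a) = 0
      rw [he, he, hp', hp', hprs a i j]
    exact congrArg PrimeSpectrum.asIdeal this
  have hconst : ∀ c : ℚ, ∃ a, pr a = fun _ => C c := fun c => (hr _).2 (by intro i j; rfl)
  have heq : ∀ i j, e i b = e j b := by
    intro i j
    obtain ⟨a, ha⟩ := hconst (e i b)
    have h1 : ∀ k, e k (g a) = e i b := by
      intro k; rw [he, hp', ha]; simp
    have h2 : b - g a ∈ RingHom.ker (e i) := by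
      rw [RingHom.mem_ker, map_sub, h1, sub_self]
    rw [hker i j, RingHom.mem_ker, map_sub, h1, sub_eq_zero] at h2
    exact h2.symm
  obtain ⟨a, ha⟩ := (hr (fun i => p i b)).2 heq
  refine ⟨a, ?_⟩
  rw [← sub_eq_zero]
  set z := g a - b with hz
  have hz0 : ∀ i, p i z = 0 := by
    intro i; rw [hz, map_sub, hp', ha]; simp
  obtain ⟨hle, hbij⟩ := hbir
  obtain ⟨w, hw⟩ := hbij.2 (algebraMap B (FractionRing B) z)
  obtain ⟨u, s, rfl⟩ := IsLocalization.exists_mk'_eq (nonZeroDivisors A) w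
  rw [IsLocalization.map_mk', IsLocalization.mk'_eq_iff_eq_mul, ← map_mul] at hw
  have hw' := IsFractionRing.injective B (FractionRing B) hw
  have hu : u = 0 := by
    apply hinj
    ext1 i
    rw [← hp', hw', map_mul, hz0, zero_mul, map_zero]; rfl
  rw [hu, map_zero] at hw'
  have := hle s.2
  rw [Submonoid.mem_comap, mem_nonZeroDivisors_iff_right] at this
  exact this _ hw'.symm

open Polynomial in
/-- Tuples of polynomials with a common value at the origin. -/
noncomputable def AxSub : Subalgebra ℚ (Fin 4 → ℚ[X]) where
  carrier := {f | ∀ i j, (f i).eval 0 = (f j).eval 0}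
  mul_mem' := by
    intro a b ha hb i j
    simp only [Pi.mul_apply, eval_mul, ha i j, hb i j]
  add_mem' := by
    intro a b ha hb i j
    simp only [Pi.add_apply, eval_add, ha i j, hb i j]
  algebraMap_mem' := by
    intro r i j
    simp

/-- Projection to a component. -/
noncomputable def axPr (i : Fin 4) : AxSub →ₐ[ℚ] Polynomial ℚ :=
  (Pi.evalAlgHom ℚ _ i).comp AxSub.val

theorem axPr_ext {a b : AxSub} (h : ∀ i, axPr i a = axPr i b) : a = b :=
  Subtype.ext (funext h)

theorem axPr_eval (a : AxSub) (i j : Fin 4) : (axPr i a).eval 0 = (axPr j a).eval 0 := a.2 i j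

/-- Coordinate functions. -/
noncomputable def axT (i : Fin 4) : AxSub := ⟨Pi.single i Polynomial.X, by
  have : ∀ j, ((Pi.single i Polynomial.X : Fin 4 → Polynomial ℚ) j).eval 0 = 0 := by
    intro j
    by_cases h : j = i
    · subst h; simp
    · simp [Pi.single_eq_of_ne h]
  intro j k; rw [this, this]⟩

theorem axPr_axT (i j : Fin 4) : axPr j (axT i) = if j = i then Polynomial.X else 0 := by
  change (Pi.single i Polynomial.X : Fin 4 → Polynomial ℚ) j = _
  rw [Pi.single_apply]

/-- Parametrization of the axes. -/
noncomputable def axPhi : MvPolynomial (Fin 4) ℚ →ₐ[ℚ] AxSub := MvPolynomial.aeval axT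

theorem mk_XX (i j : Fin 4) (h : i ≠ j) : (Ideal.Quotient.mk _ (MvPolynomial.X i) : FourAxes) *
    Ideal.Quotient.mk _ (MvPolynomial.X j) = 0 := by
  rw [← map_mul, Ideal.Quotient.eq_zero_iff_mem]
  apply Ideal.subset_span
  rcases lt_or_gt_of_ne h with h | h
  · exact ⟨i, j, h, rfl⟩
  · exact ⟨j, i, h, mul_comm _ _⟩

theorem axes_normal_form (p : MvPolynomial (Fin 4) ℚ) : ∃ (c : ℚ) (q : Fin 4 → Polynomial ℚ),
    (Ideal.Quotient.mk _ p : FourAxes) = Ideal.Quotient.mk _ (MvPolynomial.C c +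
      ∑ j, MvPolynomial.X j * Polynomial.aeval (MvPolynomial.X j) (q j)) := by
  induction p using MvPolynomial.induction_on with
  | C a => exact ⟨a, 0, by simp⟩
  | add p p' h h' =>
    obtain ⟨c, q, h⟩ := h
    obtain ⟨c', q', h'⟩ := h'
    refine ⟨c + c', q + q', ?_⟩
    rw [map_add, h, h', ← map_add]
    congr 1
    simp only [map_add, Pi.add_apply, mul_add, Finset.sum_add_distrib]
    ring
  | mul_X p i h =>
    obtain ⟨c, q, h⟩ := h
    refine ⟨0, Pi.single i (Polynomial.C c + Polynomial.X * q i), ?_⟩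
    have hR : ∑ j, (MvPolynomial.X j : MvPolynomial (Fin 4) ℚ) *
        Polynomial.aeval (MvPolynomial.X j)
          ((Pi.single i (Polynomial.C c + Polynomial.X * q i) : Fin 4 → Polynomial ℚ) j) =
        MvPolynomial.X i * Polynomial.aeval (MvPolynomial.X i)
          (Polynomial.C c + Polynomial.X * q i) := by
      rw [Finset.sum_eq_single i]
      · rw [Pi.single_eq_same]
      · intro j _ hj; simp [Pi.single_eq_of_ne hj]
      · simp
    rw [map_mul, h, hR, map_add, add_mul, map_sum, Finset.sum_mul, Finset.sum_eq_single i]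
    rotate_left
    · intro j _ hj
      rw [map_mul, mul_right_comm, mk_XX j i hj, zero_mul]
    · simp
    rw [← map_mul, ← map_mul, ← map_add]
    congr 1
    simp
    ring

theorem axPhi_pr (i j : Fin 4) (q : Polynomial ℚ) :
    axPr j (axPhi (MvPolynomial.X i * Polynomial.aeval (MvPolynomial.X i) q)) =
      if j = i then Polynomial.X * q else 0 := by
  rw [map_mul, map_mul, ← Polynomial.aeval_algHom_apply, ← Polynomial.aeval_algHom_apply]
  simp only [axPhi, MvPolynomial.aeval_X, axPr_axT]
  split_ifs <;> simp

theorem axPhi_pr_sum (j : Fin 4) (c : ℚ) (q : Fin 4 → Polynomial ℚ) :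
    axPr j (axPhi (MvPolynomial.C c +
      ∑ j, MvPolynomial.X j * Polynomial.aeval (MvPolynomial.X j) (q j))) =
      Polynomial.C c + Polynomial.X * q j := by
  rw [map_add, map_add, map_sum, map_sum]
  simp only [axPhi_pr]
  simp [axPhi]

theorem axPhi_surj : Function.Surjective axPhi := by
  intro a
  refine ⟨MvPolynomial.C ((axPr 0 a).eval 0) + ∑ j, MvPolynomial.X j *
    Polynomial.aeval (MvPolynomial.X j) ((axPr j a).divX), ?_⟩
  apply axPr_ext
  intro i
  rw [axPhi_pr_sum, axPr_eval a 0 i, ← Polynomial.coeff_zero_eq_eval_zero, add_comm,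
    Polynomial.X_mul_divX_add]

theorem axPhi_ker : RingHom.ker axPhi =
    Ideal.span {p : MvPolynomial (Fin 4) ℚ | ∃ i j : Fin 4, i < j ∧ p = MvPolynomial.X i * MvPolynomial.X j} := by
  have hle : Ideal.span {p : MvPolynomial (Fin 4) ℚ | ∃ i j : Fin 4, i < j ∧ p = MvPolynomial.X i * MvPolynomial.X j} ≤ RingHom.ker axPhi := by
    rw [Ideal.span_le]
    rintro _ ⟨i, j, hij, rfl⟩
    change axPhi _ = 0
    apply axPr_ext
    intro k
    simp only [axPhi, map_mul, MvPolynomial.aeval_X, axPr_axT, map_zero]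
    split_ifs with h1 h2
    · exact absurd (h1.symm.trans h2) hij.ne
    all_goals simp
  refine le_antisymm ?_ hle
  intro p hp
  obtain ⟨c, q, h⟩ := axes_normal_form p
  have h1 := hle (Ideal.Quotient.eq.1 h)
  rw [RingHom.mem_ker] at hp h1
  rw [map_sub, hp, zero_sub, neg_eq_zero] at h1
  have h2 : ∀ j, Polynomial.C c + Polynomial.X * q j = 0 := by
    intro j
    rw [← axPhi_pr_sum, h1, map_zero]
  have hc : c = 0 := by
    have := congrArg (Polynomial.eval 0) (h2 0)
    simpa using this
  have hq : ∀ j, q j = 0 := by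
    intro j
    have := h2 j
    simpa [hc] using this
  rw [← Ideal.Quotient.eq_zero_iff_mem, h]
  simp [hc, hq]

theorem axSub_equiv : Nonempty (AxSub ≃+* FourAxes) :=
  ⟨((Ideal.quotEquivOfEq axPhi_ker.symm).trans
    (RingHom.quotientKerEquivOfSurjective (f := axPhi.toRingHom) axPhi_surj)).symm⟩

/-- Parametrization of the lines. -/
noncomputable def lnPhi : MvPolynomial (Fin 2) ℚ →ₐ[ℚ] AxSub :=
  MvPolynomial.aeval ![axT 1 + axT 2 + axT 3, axT 0 + axT 2 - axT 3]

theorem lnPhi_X0 : lnPhi (MvPolynomial.X 0) = axT 1 + axT 2 + axT 3 := by simp [lnPhi]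
theorem lnPhi_X1 : lnPhi (MvPolynomial.X 1) = axT 0 + axT 2 - axT 3 := by simp [lnPhi]

theorem dvd_of_line (i : Fin 4) (l u : MvPolynomial (Fin 2) ℚ)
    (h0 : l ∣ MvPolynomial.X 0 - Polynomial.aeval u (axPr i (lnPhi (MvPolynomial.X 0))))
    (h1 : l ∣ MvPolynomial.X 1 - Polynomial.aeval u (axPr i (lnPhi (MvPolynomial.X 1))))
    (p : MvPolynomial (Fin 2) ℚ) (hp : axPr i (lnPhi p) = 0) : l ∣ p := by
  have h : Ideal.Quotient.mkₐ ℚ (Ideal.span {l}) = (Ideal.Quotient.mkₐ ℚ (Ideal.span {l})).comp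
      ((Polynomial.aeval u).comp ((axPr i).comp lnPhi)) := by
    apply MvPolynomial.algHom_ext
    intro j
    simp only [AlgHom.comp_apply, Ideal.Quotient.mkₐ_eq_mk]
    rw [Ideal.Quotient.eq, Ideal.mem_span_singleton]
    fin_cases j
    · exact h0
    · exact h1
  have h2 := DFunLike.congr_fun h p
  simp only [AlgHom.comp_apply, Ideal.Quotient.mkₐ_eq_mk, hp, map_zero] at h2
  rwa [Ideal.Quotient.eq_zero_iff_mem, Ideal.mem_span_singleton] at h2

theorem lnPhi_ker : RingHom.ker lnPhi = Ideal.span {(MvPolynomial.X 0 : MvPolynomial (Fin 2) ℚ) *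
    MvPolynomial.X 1 * (MvPolynomial.X 0 ^ 2 - MvPolynomial.X 1 ^ 2)} := by
  apply le_antisymm
  · intro p hp
    rw [RingHom.mem_ker] at hp
    have hp' : ∀ i, axPr i (lnPhi p) = 0 := fun i => by rw [hp, map_zero]
    have hX : (Polynomial.X : Polynomial ℚ) ≠ 0 := Polynomial.X_ne_zero
    obtain ⟨p, rfl⟩ := dvd_of_line 0 (MvPolynomial.X 0) (MvPolynomial.X 1)
      (by simp [lnPhi_X0, axPr_axT]) (by simp [lnPhi_X1, axPr_axT]) p (hp' 0)
    simp only [map_mul, mul_eq_zero, lnPhi_X0, map_add, axPr_axT] at hp'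
    obtain ⟨p, rfl⟩ := dvd_of_line 1 (MvPolynomial.X 1) (MvPolynomial.X 0)
      (by simp [lnPhi_X0, axPr_axT]) (by simp [lnPhi_X1, axPr_axT]) p
      ((hp' 1).resolve_left (by simp))
    simp only [map_mul, mul_eq_zero, lnPhi_X1, map_add, map_sub, axPr_axT] at hp'
    obtain ⟨p, rfl⟩ := dvd_of_line 2 (MvPolynomial.X 0 - MvPolynomial.X 1) (MvPolynomial.X 0)
      (by simp [lnPhi_X0, axPr_axT])
      (by simp [lnPhi_X1, axPr_axT]; rw [← neg_sub, neg_dvd]) p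
      (((hp' 2).resolve_left (by simp)).resolve_left (by simp))
    have h3 := ((hp' 3).resolve_left (by simp)).resolve_left (by simp)
    simp only [map_mul, map_sub, mul_eq_zero, lnPhi_X1, lnPhi_X0, map_add, axPr_axT] at h3
    obtain ⟨p, rfl⟩ := dvd_of_line 3 (MvPolynomial.X 0 + MvPolynomial.X 1) (MvPolynomial.X 0)
      (by simp [lnPhi_X0, axPr_axT])
      (by simp [lnPhi_X1, axPr_axT, add_comm]) p
      (h3.resolve_left (by simp [← two_mul]))
    rw [Ideal.mem_span_singleton]
    exact ⟨p, by ring⟩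
  · rw [Ideal.span_singleton_le_iff_mem, RingHom.mem_ker]
    apply axPr_ext
    intro i
    simp only [map_mul, map_sub, map_pow, lnPhi_X0, lnPhi_X1, map_add, axPr_axT, map_zero]
    fin_cases i <;> simp

/-- The induced map from the ring of four lines. -/
noncomputable def lnR : FourLines →+* AxSub :=
  Ideal.Quotient.lift _ lnPhi.toRingHom (fun a ha => by
    rw [← lnPhi_ker] at ha; exact ha)

theorem lnR_inj : Function.Injective lnR :=
  RingHom.lift_injective_of_ker_le_ideal _ _ lnPhi_ker.le

theorem lnR_mk (p) : lnR (Ideal.Quotient.mk _ p) = lnPhi p := rfl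

theorem lnPhi_cube_of (i : Fin 4) (c u : MvPolynomial (Fin 2) ℚ)
    (hc : lnPhi c = axT i ^ 3) (hu : axPr i (lnPhi u) = Polynomial.X) (a : AxSub) :
    lnPhi (c * Polynomial.aeval u (axPr i a)) = axT i ^ 3 * a := by
  apply axPr_ext
  intro j
  rw [map_mul, hc, map_mul, map_mul, ← Polynomial.aeval_algHom_apply,
    ← Polynomial.aeval_algHom_apply, map_pow, axPr_axT]
  split_ifs with h
  · subst h; rw [hu]; simp
  · simp

theorem lnR_cube (i : Fin 4) (a : AxSub) : ∃ s, lnR s = axT i ^ 3 * a := by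
  suffices h : ∃ c u : MvPolynomial (Fin 2) ℚ, lnPhi c = axT i ^ 3 ∧
      axPr i (lnPhi u) = Polynomial.X by
    obtain ⟨c, u, hc, hu⟩ := h
    exact ⟨Ideal.Quotient.mk _ _, lnPhi_cube_of i c u hc hu a⟩
  have hh : (MvPolynomial.C (1/2) : MvPolynomial (Fin 2) ℚ) = algebraMap ℚ _ (1/2) := rfl
  have h2 : (algebraMap ℚ (Polynomial ℚ) (1/2)) * 2 = 1 := by
    rw [← map_ofNat (algebraMap ℚ (Polynomial ℚ)) 2, ← map_mul]; norm_num
  set x : MvPolynomial (Fin 2) ℚ := MvPolynomial.X 0 with hx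
  set y : MvPolynomial (Fin 2) ℚ := MvPolynomial.X 1 with hy
  have hc : ∀ c, (∀ j, axPr j (lnPhi c) = axPr j (axT i) ^ 3) → lnPhi c = axT i ^ 3 :=
    fun c h => axPr_ext (fun j => by rw [h, map_pow])
  fin_cases i
  · refine ⟨-(y * (x^2 - y^2)), y, hc _ ?_, by simp [hy, lnPhi_X1, axPr_axT]⟩
    intro j
    simp only [map_neg, map_mul, map_sub, map_pow, hx, hy, lnPhi_X0, lnPhi_X1, map_add, axPr_axT]
    fin_cases j <;> simp <;> ring
  · refine ⟨(x * (x^2 - y^2)), x, hc _ ?_, by simp [hx, lnPhi_X0, axPr_axT]⟩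
    intro j
    simp only [map_neg, map_mul, map_sub, map_pow, hx, hy, lnPhi_X0, lnPhi_X1, map_add, axPr_axT]
    fin_cases j <;> simp <;> ring
  · refine ⟨algebraMap ℚ _ (1/2) * (x * y * (x + y)), x, hc _ ?_,
      by simp [hx, lnPhi_X0, axPr_axT]⟩
    intro j
    simp only [map_neg, map_mul, map_sub, map_pow, hx, hy, lnPhi_X0, lnPhi_X1, map_add, axPr_axT,
      AlgHom.commutes]
    fin_cases j <;> simp only [Fin.reduceFinMk, Fin.isValue, Fin.reduceEq, if_true, if_false,
      Fin.zero_eta, Fin.mk_one]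
    · ring
    · ring
    · linear_combination (Polynomial.X ^ 3) * h2
    · ring
  · refine ⟨- (algebraMap ℚ _ (1/2) * (x * y * (x - y))), x, hc _ ?_,
      by simp [hx, lnPhi_X0, axPr_axT]⟩
    intro j
    simp only [map_neg, map_mul, map_sub, map_pow, hx, hy, lnPhi_X0, lnPhi_X1, map_add, axPr_axT,
      AlgHom.commutes]
    fin_cases j <;> simp only [Fin.reduceFinMk, Fin.isValue, Fin.reduceEq, if_true, if_false,
      Fin.zero_eta, Fin.mk_one]
    · ring
    · ring
    · ring
    · linear_combination (Polynomial.X ^ 3) * h2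

theorem lnR_const (a : AxSub) : ∃ s, a - lnR s ∈ Ideal.span (Set.range axT) := by
  obtain ⟨p, rfl⟩ := axPhi_surj a
  induction p using MvPolynomial.induction_on with
  | C c =>
    refine ⟨Ideal.Quotient.mk _ (MvPolynomial.C c), ?_⟩
    rw [lnR_mk]
    simp [axPhi, lnPhi]
  | add p q hp hq =>
    obtain ⟨s, hs⟩ := hp
    obtain ⟨s', hs'⟩ := hq
    refine ⟨s + s', ?_⟩
    have := add_mem hs hs'
    rw [map_add, map_add]
    convert this using 1
    ring
  | mul_X p i _ =>
    refine ⟨0, ?_⟩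
    rw [map_zero, sub_zero, map_mul]
    apply Ideal.mul_mem_left
    apply Ideal.subset_span
    exact ⟨i, by simp [axPhi]⟩

theorem lnR_cond : ∃ d, lnR d ∈ nonZeroDivisors AxSub ∧ ∀ a, ∃ s, lnR s = lnR d * a := by
  choose s hs using lnR_cube
  refine ⟨∑ i, s i 1, ?_, ?_⟩
  · rw [mem_nonZeroDivisors_iff_right]
    intro z hz
    apply axPr_ext
    intro i
    have := congrArg (axPr i) hz
    simpa [hs, axPr_axT] using this
  · intro a
    refine ⟨∑ i, s i a, ?_⟩
    simp [hs, Finset.sum_mul]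

theorem lnR_finite : lnR.Finite := by
  algebraize [lnR]
  obtain ⟨d, hd, hd'⟩ := lnR_cond
  change Module.Finite FourLines AxSub
  let N := LinearMap.range (Algebra.linearMap FourLines AxSub)
  let F : AxSub →ₗ[FourLines] N := (LinearMap.mulLeft FourLines (lnR d)).codRestrict N
    (fun a => by obtain ⟨s, hs⟩ := hd' a; exact ⟨s, hs⟩)
  apply Module.Finite.of_injective F
  intro a b hab
  have : lnR d * a = lnR d * b := congrArg Subtype.val hab
  exact (mul_cancel_left_mem_nonZeroDivisors hd).1 this

theorem bijective_of_between {S A : Type} [CommRing S] [CommRing A] (j : FourLines →+* S)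
    (f : S →+* A) (hfinj : Function.Injective f) (e' : AxSub ≃+* A)
    (hfR : ∀ r, f (j r) = e' (lnR r)) (hSsn : IsSeminormalRing S) : Function.Bijective f := by
  obtain ⟨d, hd, hdA⟩ := lnR_cond
  have hffin : RingHom.Finite (A := S) (B := A) f := by
    apply RingHom.Finite.of_comp_finite (A := FourLines) (B := S) (C := A) (f := j)
    have : f.comp j = e'.toRingHom.comp lnR := RingHom.ext hfR
    rw [this]
    exact RingHom.Finite.comp (RingHom.Finite.of_surjective _ e'.surjective) lnR_finite
  have hfbir : IsBirationalHom (A := S) (B := A) f := by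
    refine birational_of_conductor (S := S) (A := A) f hfinj (j d) ?_ ?_
    · rw [hfR, mem_nonZeroDivisors_iff_right]
      rw [mem_nonZeroDivisors_iff_right] at hd
      intro z hz
      obtain ⟨z, rfl⟩ := e'.surjective z
      rw [← map_mul] at hz
      rw [hd z (e'.injective (by rw [hz, map_zero])), map_zero]
    · intro a
      obtain ⟨a, rfl⟩ := e'.surjective a
      obtain ⟨s, hs⟩ := hdA a
      exact ⟨j s, by rw [hfR, hfR, hs, map_mul]⟩
  obtain ⟨hspec, hres⟩ := spec_of_conductor (S := S) (A := A) f hfinj hffin (fun i => e' (axT i))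
    (fun i a => by
      obtain ⟨a, rfl⟩ := e'.surjective a
      obtain ⟨s, hs⟩ := lnR_cube i a
      exact ⟨j s, by rw [hfR, hs, map_mul, map_pow]⟩)
    (fun a => by
      obtain ⟨a, rfl⟩ := e'.surjective a
      obtain ⟨s, hs⟩ := lnR_const a
      refine ⟨j s, ?_⟩
      rw [hfR, ← map_sub]
      have h := Ideal.mem_map_of_mem e' hs
      rw [Ideal.map_span, ← Set.range_comp] at h
      exact h)
  exact hSsn A f hfinj hffin hfbir hspec hres

theorem fourLines_aux (S : Subalgebra FourLines (FractionRing FourLines))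
    (hS : IsSeminormalization FourLines S) : Nonempty (↥S ≃+* FourAxes) := by
  obtain ⟨d, hd, hdA⟩ := lnR_cond
  obtain ⟨hle, hbij⟩ := birational_of_conductor lnR lnR_inj d hd hdA
  let E := RingEquiv.ofBijective _ hbij
  let ψ : AxSub →+* FractionRing FourLines :=
    E.symm.toRingHom.comp (algebraMap AxSub (FractionRing AxSub))
  have hψinj : Function.Injective ψ :=
    E.symm.injective.comp (IsFractionRing.injective AxSub (FractionRing AxSub))
  have hψ : ∀ r, ψ (lnR r) = algebraMap FourLines (FractionRing FourLines) r := by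
    intro r
    change E.symm (algebraMap AxSub (FractionRing AxSub) (lnR r)) = _
    rw [RingEquiv.symm_apply_eq]
    exact (IsLocalization.map_eq (T := nonZeroDivisors AxSub) hle r).symm
  let A : Subalgebra FourLines (FractionRing FourLines) :=
    { ψ.range with
      algebraMap_mem' := fun r => ⟨lnR r, hψ r⟩ }
  let e : AxSub →+* A := ψ.codRestrict A (fun x => ⟨x, rfl⟩)
  have heb : Function.Bijective e := by
    constructor
    · intro x y h
      exact hψinj (congrArg Subtype.val h)
    · rintro ⟨_, x, rfl⟩
      exact ⟨x, rfl⟩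
  let e' : AxSub ≃+* A := RingEquiv.ofBijective e heb
  have hRA : e'.toRingHom.comp lnR = algebraMap FourLines A := by
    refine RingHom.ext fun r => ?_
    exact Subtype.ext (hψ r)
  have hRA' : ∀ r, e' (lnR r) = algebraMap FourLines A r := fun r => RingHom.congr_fun hRA r
  have hfinA : RingHom.Finite (A := FourLines) (B := A) (algebraMap FourLines A) := by
    rw [← hRA]
    exact RingHom.Finite.comp (RingHom.Finite.of_surjective _ e'.surjective) lnR_finite
  have hAint : A ≤ integralClosure FourLines (FractionRing FourLines) := by
    intro x hx
    have h1 : IsIntegral FourLines (⟨x, hx⟩ : A) := hfinA.to_isIntegral _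
    exact h1.map A.val
  have hAsn : IsSeminormalRing A := by
    refine seminormal_axes A (AxSub.val.toRingHom.comp e'.symm.toRingHom) ?_ ?_
    · exact Subtype.val_injective.comp e'.symm.injective
    · intro x
      constructor
      · rintro ⟨a, rfl⟩
        exact (e'.symm a).2
      · intro hx
        refine ⟨e' ⟨x, hx⟩, ?_⟩
        change ((e'.symm (e' ⟨x, hx⟩) : AxSub) : Fin 4 → Polynomial ℚ) = x
        rw [RingEquiv.symm_apply_apply]
  obtain ⟨_, hSsn, hmin⟩ := hS
  have hSA : S ≤ A := hmin A hAint hAsn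
  let f : S →+* A := (Subalgebra.inclusion hSA).toRingHom
  have hfR : ∀ r, f (algebraMap FourLines S r) = e' (lnR r) := by
    intro r
    rw [hRA']
    rfl
  have hfb := bijective_of_between (S := S) (A := A) (algebraMap FourLines S) f
    (Subalgebra.inclusion_injective hSA) e' hfR hSsn
  obtain ⟨E2⟩ := axSub_equiv
  exact ⟨((RingEquiv.ofBijective f hfb).trans e'.symm).trans E2⟩

/-- The seminormalization of the coordinate ring of four distinct lines
through the origin in the plane is isomorphic to the coordinate ring of the four
coordinate axes in affine 4-space. -/
theorem statement9 :
    ∀ S : Subalgebra FourLines (FractionRing FourLines),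
      IsSeminormalization FourLines S → Nonempty (↥S ≃+* FourAxes) := by
  exact fourLines_aux
end
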